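/- Let n ≥ 1 and let S ⊆ ℝ^n be a Borel set with S ∩ (−S) = ∅ and 0 < Vol_n(S) < ∞, and write λ = Vol_n(S). Let μ be any SL_n(ℝ)-invariant Borel probability measure on the space 𝒳_n of covolume-one lattices in ℝ^n. Let f be a bounded Borel function on the finite subsets of S such that f(X) = 0 whenever |X| ≥ n. Then ∫_{𝒳_n} ( Σ_{X ⊆ L ∩ S} f(X)·ι(X) ) dμ(L) = E_λ[A ↦ Σ_{X ⊆ A} f(X)], where on the left the sum runs over all subsets X of L ∩ S (the integrand being defined for μ-almost every L, since L ∩ S is finite for μ-almost every L). -/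

import Mathlib

open MeasureTheory Pointwise
open scoped ENNReal

noncomputable section

/-- `SL(n, ℝ)`, the special linear group of `n × n` real matrices of determinant one. -/
abbrev SLR (n : ℕ) := Matrix.SpecialLinearGroup (Fin n) ℝ

/-- The topology on `SL(n, ℝ)` induced from the space of matrices. -/
instance (n : ℕ) : TopologicalSpace (SLR n) :=
  TopologicalSpace.induced (fun g => (g : Matrix (Fin n) (Fin n) ℝ)) inferInstance

/-- The subgroup `SL(n, ℤ)` of `SL(n, ℝ)` (the range of the coefficient-wise
integer-to-real map on special linear groups). -/
def SLZ (n : ℕ) : Subgroup (SLR n) :=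
  MonoidHom.range (Matrix.SpecialLinearGroup.map (n := Fin n) (Int.castRingHom ℝ))

/-- The space `𝒳ₙ = SL(n, ℝ) / SL(n, ℤ)` of lattices of covolume one in `ℝⁿ`. -/
def LatticeSpace (n : ℕ) := SLR n ⧸ SLZ n

instance (n : ℕ) : TopologicalSpace (LatticeSpace n) :=
  inferInstanceAs (TopologicalSpace (SLR n ⧸ SLZ n))

/-- The Borel σ-algebra on the space of lattices. -/
instance (n : ℕ) : MeasurableSpace (LatticeSpace n) := borel _

/-- The action of `SL(n, ℝ)` on the space of lattices, `g.L = {g x : x ∈ L}`. -/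
instance (n : ℕ) : MulAction (SLR n) (LatticeSpace n) :=
  inferInstanceAs (MulAction (SLR n) (SLR n ⧸ SLZ n))

/-- The lattice `{g v : v ∈ ℤⁿ} ⊆ ℝⁿ` associated to a point of `LatticeSpace n`,
computed via a representative `g` of the coset (the resulting set of vectors does not
depend on the choice of representative, since `SL(n, ℤ)` preserves `ℤⁿ`). -/
def latticeOf {n : ℕ} (L : LatticeSpace n) : Set (Fin n → ℝ) :=
  {y | ∃ v : Fin n → ℤ,
    y = (Quotient.out (α := SLR n) L).1.mulVec (fun i => (v i : ℝ))}

/-- A set `X ⊆ ℝⁿ` consists of linearly independent vectors. -/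
def indepSet {n : ℕ} (X : Set (Fin n → ℝ)) : Prop :=
  LinearIndependent ℝ (fun x : X => (x : Fin n → ℝ))

open scoped Classical in
/-- `ι(X) = 1` if the vectors of `X` are linearly independent and `ι(X) = 0` otherwise
(in particular `ι(∅) = 1` and `ι({0}) = 0`). -/
def iota {n : ℕ} (X : Set (Fin n → ℝ)) : ℝ :=
  if indepSet X then 1 else 0

section

open Filter Topology

/-! ### The space of lattices as a topological and measurable space -/

section LatticeSpace

variable {n : ℕ}

instance : IsTopologicalGroup (SLR n) :=
  Matrix.SpecialLinearGroup.topologicalGroup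

theorem continuous_coe_SLR : Continuous (fun g : SLR n => (g : Matrix (Fin n) (Fin n) ℝ)) :=
  continuous_induced_dom

instance : PolishSpace (SLR n) :=
  have : PolishSpace (Matrix (Fin n) (Fin n) ℝ) :=
    inferInstanceAs (PolishSpace (Fin n → Fin n → ℝ))
  (Matrix.SpecialLinearGroup.isClosedEmbedding_val (n := Fin n) (R := ℝ)).polishSpace

theorem isClosed_SLZ : IsClosed (SLZ n : Set (SLR n)) :=
  (Topology.IsClosedEmbedding.specialLinearGroup_map (n := Fin n) (f := Int.castRingHom ℝ)
    Int.isClosedEmbedding_coe_real).isClosed_range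

/-- The lattice `g ℤⁿ` as a point of the space of lattices. -/
def latticeMk (g : SLR n) : LatticeSpace n := QuotientGroup.mk (s := SLZ n) g

theorem latticeMk_surjective : Function.Surjective (latticeMk (n := n)) :=
  QuotientGroup.mk_surjective

theorem continuous_latticeMk : Continuous (latticeMk (n := n)) :=
  QuotientGroup.continuous_mk

theorem smul_latticeMk (g h : SLR n) : g • latticeMk h = latticeMk (g * h) := rfl

instance : BorelSpace (LatticeSpace n) := ⟨rfl⟩

instance : T1Space (LatticeSpace n) :=
  have : IsClosed (SLZ n : Set (SLR n)) := isClosed_SLZ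
  inferInstanceAs (T1Space (SLR n ⧸ SLZ n))

instance : SecondCountableTopology (LatticeSpace n) :=
  inferInstanceAs (SecondCountableTopology (SLR n ⧸ SLZ n))

instance : ContinuousSMul (SLR n) (LatticeSpace n) :=
  inferInstanceAs (ContinuousSMul (SLR n) (SLR n ⧸ SLZ n))

/-- Measurability on the space of lattices can be tested on `SL(n, ℝ)`. -/
theorem measurable_of_comp_latticeMk {β : Type*} [MeasurableSpace β] {H : LatticeSpace n → β}
    (h : @Measurable _ _ (borel (SLR n)) _ (H ∘ latticeMk)) : Measurable H := by
  borelize (SLR n)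
  exact (continuous_latticeMk.measurable.measurable_comp_iff_of_surjective
    latticeMk_surjective).1 h

end LatticeSpace

/-! ### Sums over tuples of lattice vectors -/

section TupleSum

variable {n k : ℕ}

/-- The action of a matrix on tuples of vectors. -/
def tupleMulVec (g : Matrix (Fin n) (Fin n) ℝ) (x : Fin k → Fin n → ℝ) : Fin k → Fin n → ℝ :=
  fun i => g.mulVec (x i)

/-- An integer tuple regarded as a real one. -/
def intTuple (v : Fin k → Fin n → ℤ) : Fin k → Fin n → ℝ := fun i l => (v i l : ℝ)

/-- The sum of `h` over all `k`-tuples of vectors of the lattice `L`. -/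
def tupleSum (h : (Fin k → Fin n → ℝ) → ℝ≥0∞) (L : LatticeSpace n) : ℝ≥0∞ :=
  ∑' v : Fin k → Fin n → ℤ, h (tupleMulVec (Quotient.out (α := SLR n) L).1 (intTuple v))

theorem tupleMulVec_mul (g g' : Matrix (Fin n) (Fin n) ℝ) (x : Fin k → Fin n → ℝ) :
    tupleMulVec (g * g') x = tupleMulVec g (tupleMulVec g' x) := by
  ext i; simp [tupleMulVec, Matrix.mulVec_mulVec]

theorem continuous_tupleMulVec :
    Continuous fun p : Matrix (Fin n) (Fin n) ℝ × (Fin k → Fin n → ℝ) =>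
      tupleMulVec p.1 p.2 := by
  unfold tupleMulVec
  fun_prop

/-- An element of `SL(n, ℤ)` permutes the integer tuples. -/
def intTupleEquiv (γ : Matrix.SpecialLinearGroup (Fin n) ℤ) :
    (Fin k → Fin n → ℤ) ≃ (Fin k → Fin n → ℤ) where
  toFun v i := γ.1.mulVec (v i)
  invFun v i := (γ⁻¹).1.mulVec (v i)
  left_inv v := by
    ext1 i
    simp only [Matrix.mulVec_mulVec]
    rw [← Matrix.SpecialLinearGroup.coe_mul]; simp
  right_inv v := by
    ext1 i
    simp only [Matrix.mulVec_mulVec]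
    rw [← Matrix.SpecialLinearGroup.coe_mul]; simp

theorem exists_out_latticeMk (g : SLR n) : ∃ γ : Matrix.SpecialLinearGroup (Fin n) ℤ,
    (Quotient.out (α := SLR n) (latticeMk g)) =
      g * Matrix.SpecialLinearGroup.map (n := Fin n) (Int.castRingHom ℝ) γ := by
  obtain ⟨⟨_, γ, rfl⟩, h⟩ := QuotientGroup.mk_out_eq_mul (SLZ n) g
  exact ⟨γ, h⟩

theorem tupleMulVec_intTuple (γ : Matrix.SpecialLinearGroup (Fin n) ℤ)
    (v : Fin k → Fin n → ℤ) :
    tupleMulVec (Matrix.SpecialLinearGroup.map (n := Fin n) (Int.castRingHom ℝ) γ).1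
      (intTuple v) = intTuple (intTupleEquiv γ v) := by
  ext i l
  simp [tupleMulVec, intTuple, intTupleEquiv, Matrix.mulVec, dotProduct]

theorem tupleSum_latticeMk (h : (Fin k → Fin n → ℝ) → ℝ≥0∞) (g : SLR n) :
    tupleSum h (latticeMk g) = ∑' v : Fin k → Fin n → ℤ, h (tupleMulVec g.1 (intTuple v)) := by
  obtain ⟨γ, hγ⟩ := exists_out_latticeMk g
  unfold tupleSum
  rw [hγ, ← (intTupleEquiv γ).tsum_eq
    (fun v : Fin k → Fin n → ℤ => h (tupleMulVec g.1 (intTuple v)))]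
  refine tsum_congr fun v => ?_
  rw [Matrix.SpecialLinearGroup.coe_mul, tupleMulVec_mul, tupleMulVec_intTuple]

theorem measurable_tupleSum {h : (Fin k → Fin n → ℝ) → ℝ≥0∞} (hh : Measurable h) :
    Measurable (tupleSum h) := by
  apply measurable_of_comp_latticeMk
  borelize (SLR n)
  have : tupleSum h ∘ latticeMk =
      fun g => ∑' v : Fin k → Fin n → ℤ, h (tupleMulVec g.1 (intTuple v)) :=
    funext fun g => tupleSum_latticeMk h g
  rw [this]
  refine Measurable.tsum fun v => hh.comp ?_
  exact (continuous_tupleMulVec.comp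
    (continuous_coe_SLR.prodMk continuous_const)).measurable

theorem tupleSum_smul (h : (Fin k → Fin n → ℝ) → ℝ≥0∞) (g : SLR n) (L : LatticeSpace n) :
    tupleSum h (g • L) = tupleSum (fun x => h (tupleMulVec g.1 x)) L := by
  obtain ⟨a, rfl⟩ := latticeMk_surjective L
  rw [smul_latticeMk, tupleSum_latticeMk, tupleSum_latticeMk]
  simp_rw [Matrix.SpecialLinearGroup.coe_mul, tupleMulVec_mul]

/-- The measure on `k`-tuples obtained by averaging, over random lattices, the counting measure
on the `k`-tuples of lattice vectors. -/
def tupleMeasure (k : ℕ) (μ : Measure (LatticeSpace n)) : Measure (Fin k → Fin n → ℝ) :=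
  μ.bind fun L => Measure.sum fun v : Fin k → Fin n → ℤ =>
    Measure.dirac (tupleMulVec (Quotient.out (α := SLR n) L).1 (intTuple v))

theorem lintegral_tupleMeasure (μ : Measure (LatticeSpace n))
    {h : (Fin k → Fin n → ℝ) → ℝ≥0∞} (hh : Measurable h) :
    ∫⁻ x, h x ∂(tupleMeasure k μ) = ∫⁻ L, tupleSum h L ∂μ := by
  have key : ∀ {h : (Fin k → Fin n → ℝ) → ℝ≥0∞}, Measurable h → ∀ L : LatticeSpace n,
      ∫⁻ x, h x ∂(Measure.sum fun v : Fin k → Fin n → ℤ =>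
        Measure.dirac (tupleMulVec (Quotient.out (α := SLR n) L).1 (intTuple v)))
        = tupleSum h L := by
    intro h hh L
    rw [lintegral_sum_measure]
    exact tsum_congr fun v => lintegral_dirac' _ hh
  unfold tupleMeasure
  rw [Measure.lintegral_bind _ hh.aemeasurable]
  · exact lintegral_congr fun L => key hh L
  · refine (Measure.measurable_of_measurable_coe _ fun s hs => ?_).aemeasurable
    have : ∀ L : LatticeSpace n, (Measure.sum fun v : Fin k → Fin n → ℤ =>
        Measure.dirac (tupleMulVec (Quotient.out (α := SLR n) L).1 (intTuple v))) s
        = tupleSum (s.indicator 1) L := fun L => by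
      rw [← key (measurable_one.indicator hs), lintegral_indicator_one hs]
    simp_rw [this]
    exact measurable_tupleSum (measurable_one.indicator hs)

end TupleSum

/-! ### Averaging over the group -/

/-- If the averages of `H` over translates of every lattice converge to a constant `c`, then `c` is
the mean of `H` for every invariant probability measure. -/
theorem lintegral_eq_of_tendsto_average {n : ℕ} {P : Type*} [MeasurableSpace P]
    (μ : Measure (LatticeSpace n)) [IsProbabilityMeasure μ]
    (hinv : ∀ g : SLR n, Measure.map (fun x => g • x) μ = μ)
    {H : LatticeSpace n → ℝ≥0∞} (hH : Measurable H)
    (η : Measure P) [IsProbabilityMeasure η] (g : ℕ → P → SLR n)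
    (hg : ∀ N, Measurable fun p : P × LatticeSpace n => g N p.1 • p.2)
    {c : ℝ≥0∞} (hc : ∀ L, Tendsto (fun N => ∫⁻ s, H (g N s • L) ∂η) atTop (𝓝 c)) :
    ∫⁻ L, H L ∂μ = c := by
  have avg : ∀ F : LatticeSpace n → ℝ≥0∞, Measurable F → ∀ N,
      ∫⁻ L, F L ∂μ = ∫⁻ L, ∫⁻ s, F (g N s • L) ∂η ∂μ := by
    intro F hF N
    rw [lintegral_lintegral_swap (f := fun L s => F (g N s • L))
      (((hF.comp (hg N)).comp measurable_swap).aemeasurable)]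
    have : ∀ s, ∫⁻ L, F (g N s • L) ∂μ = ∫⁻ L, F L ∂μ := fun s => by
      conv_rhs => rw [← hinv (g N s)]
      rw [lintegral_map hF (continuous_const_smul (g N s)).measurable]
    simp [this]
  have hm : ∀ F : LatticeSpace n → ℝ≥0∞, Measurable F → ∀ N,
      Measurable fun L => ∫⁻ s, F (g N s • L) ∂η := fun F hF N =>
    Measurable.lintegral_prod_left' (f := fun p : P × LatticeSpace n => F (g N p.1 • p.2))
      (hF.comp (hg N))
  apply le_antisymm
  · have hK : ∀ K : ℕ, ∫⁻ L, min (H L) K ∂μ ≤ c := by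
      intro K
      have hFm : Measurable fun L => min (H L) (K : ℝ≥0∞) := hH.min measurable_const
      have hlim : Tendsto (fun N => ∫⁻ L, min (∫⁻ s, H (g N s • L) ∂η) (K : ℝ≥0∞) ∂μ) atTop
          (𝓝 (∫⁻ _L, min c (K : ℝ≥0∞) ∂μ)) := by
        refine tendsto_lintegral_of_dominated_convergence (fun _ => (K : ℝ≥0∞))
          (fun N => (hm H hH N).min measurable_const) (fun N => ae_of_all _ fun L => min_le_right _ _)
          (by simp) (ae_of_all _ fun L => (hc L).min tendsto_const_nhds)
      have hle : ∀ N, ∫⁻ L, min (H L) (K : ℝ≥0∞) ∂μ ≤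
          ∫⁻ L, min (∫⁻ s, H (g N s • L) ∂η) (K : ℝ≥0∞) ∂μ := by
        intro N
        rw [avg _ hFm N]
        refine lintegral_mono fun L => le_min (lintegral_mono fun s => min_le_left _ _) ?_
        calc ∫⁻ s, min (H (g N s • L)) (K : ℝ≥0∞) ∂η ≤ ∫⁻ _s, (K : ℝ≥0∞) ∂η :=
              lintegral_mono fun s => min_le_right _ _
          _ = K := by simp
      refine (ge_of_tendsto' hlim hle).trans ?_
      simp
    have hsup : ∀ L, ⨆ K : ℕ, min (H L) (K : ℝ≥0∞) = H L := by
      intro L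
      rw [← inf_iSup_eq, ENNReal.iSup_natCast, inf_top_eq]
    calc ∫⁻ L, H L ∂μ = ∫⁻ L, ⨆ K : ℕ, min (H L) (K : ℝ≥0∞) ∂μ := by simp_rw [hsup]
      _ = ⨆ K : ℕ, ∫⁻ L, min (H L) (K : ℝ≥0∞) ∂μ :=
        lintegral_iSup (fun K => hH.min measurable_const)
          fun a b hab L => min_le_min le_rfl (by exact_mod_cast hab)
      _ ≤ c := iSup_le hK
  · calc c = ∫⁻ _L, c ∂μ := by simp
      _ = ∫⁻ L, liminf (fun N => ∫⁻ s, H (g N s • L) ∂η) atTop ∂μ := by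
        simp_rw [(hc _).liminf_eq]
      _ ≤ liminf (fun N => ∫⁻ L, ∫⁻ s, H (g N s • L) ∂η ∂μ) atTop :=
        lintegral_liminf_le (hm H hH)
      _ = ∫⁻ L, H L ∂μ := by simp_rw [← avg H hH]; simp

/-! ### Riemann sums over lattices of tuples -/

section RiemannSum

theorem mem_inv_smul_span_iff {ι : Type*} [Finite ι] (N : ℕ) (hN : N ≠ 0) (x : ι → ℝ) :
    x ∈ (N : ℝ)⁻¹ • (Submodule.span ℤ (Set.range (Pi.basisFun ℝ ι)) : Set (ι → ℝ)) ↔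
      x ∈ Set.range fun (v : ι → ℤ) i => (N : ℝ)⁻¹ * (v i : ℝ) := by
  have hN' : (N : ℝ) ≠ 0 := by exact_mod_cast hN
  rw [Set.mem_inv_smul_set_iff₀ hN', SetLike.mem_coe, Module.Basis.mem_span_iff_repr_mem]
  simp only [Pi.basisFun_repr, Set.mem_range]
  constructor
  · intro h
    choose v hv using h
    refine ⟨v, funext fun i => ?_⟩
    have := hv i
    simp only [algebraMap_int_eq, Int.coe_castRingHom, Pi.smul_apply, smul_eq_mul] at this
    rw [this, inv_mul_cancel_left₀ hN']
  · rintro ⟨v, rfl⟩ i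
    exact ⟨v i, by simp [hN']⟩

theorem tendsto_riemannSum_pi {ι : Type*} [Fintype ι] {F : (ι → ℝ) → ℝ} (hF : Continuous F)
    (hFc : HasCompactSupport F) :
    Tendsto (fun N : ℕ => (∑' v : ι → ℤ, F fun i => (N : ℝ)⁻¹ * (v i : ℝ)) /
      (N : ℝ) ^ Fintype.card ι) atTop (𝓝 (∫ x, F x)) := by
  obtain ⟨M, hM⟩ := hFc.isCompact.isBounded.subset_closedBall 0
  have hz : ∀ x ∉ Metric.closedBall (0 : ι → ℝ) M, F x = 0 := fun x hx =>
    image_eq_zero_of_notMem_tsupport fun h => hx (hM h)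
  have key := tendsto_tsum_div_pow_atTop_integral (Metric.closedBall (0 : ι → ℝ) M) F hF
    Metric.isBounded_closedBall measurableSet_closedBall
    ((convex_closedBall _ _).addHaar_frontier _)
  rw [setIntegral_eq_integral_of_forall_compl_eq_zero hz] at key
  refine key.congr' ?_
  filter_upwards [eventually_ne_atTop 0] with N hN
  congr 1
  have hN' : (N : ℝ)⁻¹ ≠ 0 := inv_ne_zero (by exact_mod_cast hN)
  have hinj : Function.Injective fun (v : ι → ℤ) i => (N : ℝ)⁻¹ * (v i : ℝ) := by
    intro v w h
    funext i
    have := congrFun h i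
    simpa [hN] using this
  rw [← tsum_range F hinj, tsum_subtype, tsum_subtype]
  refine tsum_congr fun x => ?_
  by_cases hx : x ∈ Metric.closedBall (0 : ι → ℝ) M
  · by_cases hx' : x ∈ Set.range fun (v : ι → ℤ) i => (N : ℝ)⁻¹ * (v i : ℝ)
    · rw [Set.indicator_of_mem hx', Set.indicator_of_mem]
      exact ⟨hx, (mem_inv_smul_span_iff N hN x).2 hx'⟩
    · rw [Set.indicator_of_notMem hx', Set.indicator_of_notMem]
      exact fun h => hx' ((mem_inv_smul_span_iff N hN x).1 h.2)
  · exact (Set.indicator_apply_eq_zero.2 fun _ => hz x hx).trans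
      (Set.indicator_apply_eq_zero.2 fun _ => hz x hx).symm

variable {n k : ℕ}

theorem volume_preserving_curry (k n : ℕ) :
    MeasurePreserving (MeasurableEquiv.curry (Fin k) (Fin n) ℝ) := by
  have : MeasurePreserving (MeasurableEquiv.curry (Fin k) (Fin n) ℝ).symm := by
    refine ⟨(MeasurableEquiv.curry (Fin k) (Fin n) ℝ).symm.measurable, ?_⟩
    symm
    refine Measure.pi_eq fun s hs => ?_
    rw [MeasurableEquiv.map_apply]
    have : (MeasurableEquiv.curry (Fin k) (Fin n) ℝ).symm ⁻¹' (Set.univ.pi s) =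
        Set.univ.pi fun i => Set.univ.pi fun l => s (i, l) := by
      ext x
      simp [Set.mem_pi, MeasurableEquiv.curry, Function.uncurry, Prod.forall]
    rw [this, volume_pi_pi]
    simp_rw [volume_pi_pi]
    rw [Fintype.prod_prod_type]
  exact this.symm _

theorem tendsto_riemannSum_tuple {F : (Fin k → Fin n → ℝ) → ℝ} (hF : Continuous F)
    (hFc : HasCompactSupport F) :
    Tendsto (fun N : ℕ => (∑' v : Fin k → Fin n → ℤ, F ((N : ℝ)⁻¹ • intTuple v)) /
      (N : ℝ) ^ (k * n)) atTop (𝓝 (∫ x, F x)) := by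
  let E : (Fin k × Fin n → ℝ) ≃ₜ (Fin k → Fin n → ℝ) :=
    { Equiv.curry (Fin k) (Fin n) ℝ with
      continuous_toFun := by
        change Continuous fun (x : Fin k × Fin n → ℝ) i l => x (i, l)
        fun_prop
      continuous_invFun := by
        change Continuous fun (x : Fin k → Fin n → ℝ) (p : Fin k × Fin n) => x p.1 p.2
        fun_prop }
  have key := tendsto_riemannSum_pi (F := F ∘ E) (hF.comp E.continuous) (hFc.comp_homeomorph E)
  have h_int : ∫ x, (F ∘ E) x = ∫ x, F x := by
    have := (volume_preserving_curry k n).integral_comp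
      (MeasurableEquiv.curry (Fin k) (Fin n) ℝ).measurableEmbedding F
    exact this
  rw [h_int] at key
  refine key.congr fun N => ?_
  rw [Fintype.card_prod, Fintype.card_fin, Fintype.card_fin]
  congr 1
  rw [← (Equiv.curry (Fin k) (Fin n) ℤ).tsum_eq]
  rfl

theorem volume_preserving_tupleMulVec (g : SLR n) :
    MeasurePreserving (tupleMulVec (k := k) g.1) := by
  have h1 : MeasurePreserving (fun x : Fin n → ℝ => g.1.mulVec x) := by
    refine ⟨by fun_prop, ?_⟩
    have := Real.map_matrix_volume_pi_eq_smul_volume_pi (M := g.1) (by simp)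
    rw [show (fun x : Fin n → ℝ => g.1.mulVec x) = Matrix.toLin' g.1 from rfl]
    simpa using this
  exact volume_preserving_pi fun _ => h1

/-- The action of an element of `SL(n, ℝ)` on tuples, as a homeomorphism. -/
def tupleMulVecHomeomorph (g : SLR n) : (Fin k → Fin n → ℝ) ≃ₜ (Fin k → Fin n → ℝ) where
  toFun := tupleMulVec g.1
  invFun := tupleMulVec (g⁻¹).1
  left_inv x := by
    rw [← tupleMulVec_mul, ← Matrix.SpecialLinearGroup.coe_mul]
    ext; simp [tupleMulVec]
  right_inv x := by
    rw [← tupleMulVec_mul, ← Matrix.SpecialLinearGroup.coe_mul]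
    ext; simp [tupleMulVec]
  continuous_toFun := continuous_tupleMulVec.comp (continuous_const.prodMk continuous_id)
  continuous_invFun := continuous_tupleMulVec.comp (continuous_const.prodMk continuous_id)

theorem tupleMulVec_smul (g : Matrix (Fin n) (Fin n) ℝ) (c : ℝ) (x : Fin k → Fin n → ℝ) :
    tupleMulVec g (c • x) = c • tupleMulVec g x := by
  ext i; simp [tupleMulVec, Matrix.mulVec_smul]

theorem tendsto_riemannSum_lattice {F : (Fin k → Fin n → ℝ) → ℝ} (hF : Continuous F)
    (hFc : HasCompactSupport F) (g : SLR n) :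
    Tendsto (fun N : ℕ => (∑' v : Fin k → Fin n → ℤ,
      F ((N : ℝ)⁻¹ • tupleMulVec g.1 (intTuple v))) /
      (N : ℝ) ^ (k * n)) atTop (𝓝 (∫ x, F x)) := by
  have key := tendsto_riemannSum_tuple (hF.comp (tupleMulVecHomeomorph g).continuous)
    (hFc.comp_homeomorph (tupleMulVecHomeomorph g))
  have h_int : ∫ x, (F ∘ tupleMulVecHomeomorph g) x = ∫ x, F x :=
    (volume_preserving_tupleMulVec g).integral_comp
      (tupleMulVecHomeomorph g).measurableEmbedding F
  rw [h_int] at key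
  simp_rw [← tupleMulVec_smul]
  exact key

theorem finite_setOf_intTuple_mem (g : SLR n) {c : ℝ} (hc : c ≠ 0)
    {K : Set (Fin k → Fin n → ℝ)} (hK : IsCompact K) :
    {v : Fin k → Fin n → ℤ | c • tupleMulVec g.1 (intTuple v) ∈ K}.Finite := by
  let E := (Homeomorph.smulOfNeZero c hc).symm.trans (tupleMulVecHomeomorph (k := k) g).symm
  obtain ⟨M, hM⟩ := (hK.image E.continuous).isBounded.subset_closedBall 0
  refine ((isCompact_closedBall (0 : Fin k → Fin n → ℤ) M).finite_of_discrete).subset ?_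
  intro v hv
  have h1 : intTuple v ∈ Metric.closedBall (0 : Fin k → Fin n → ℝ) M := by
    refine hM ⟨_, hv, ?_⟩
    apply E.symm.injective
    rw [E.symm_apply_apply]
    rfl
  rw [mem_closedBall_zero_iff] at h1 ⊢
  have hM0 : 0 ≤ M := (norm_nonneg _).trans h1
  refine (pi_norm_le_iff_of_nonneg hM0).2 fun i => (pi_norm_le_iff_of_nonneg hM0).2 fun l => ?_
  have := (norm_le_pi_norm (intTuple v i) l).trans ((norm_le_pi_norm (intTuple v) i).trans h1)
  simpa [intTuple, Int.norm_eq_abs] using this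

theorem summable_lattice {F : (Fin k → Fin n → ℝ) → ℝ} (hFc : HasCompactSupport F) (g : SLR n)
    {c : ℝ} (hc : c ≠ 0) :
    Summable fun v : Fin k → Fin n → ℤ => F (c • tupleMulVec g.1 (intTuple v)) := by
  refine summable_of_hasFiniteSupport
    ((finite_setOf_intTuple_mem g hc hFc.isCompact).subset fun v hv => subset_tsupport _ hv)

/-- A function of compact support approximated uniformly by a sequence of functions
has the same limiting Riemann sums as the sequence. -/
theorem tendsto_riemannSum_of_approx {Ψ : ℕ → (Fin k → Fin n → ℝ) → ℝ}
    {Ψ₀ χ : (Fin k → Fin n → ℝ) → ℝ} (h₀ : Continuous Ψ₀) (h₀c : HasCompactSupport Ψ₀)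
    (hΨc : ∀ᶠ N in atTop, HasCompactSupport (Ψ N))
    (hχ : Continuous χ) (hχc : HasCompactSupport χ)
    (happ : ∀ κ > 0, ∀ᶠ N in atTop, ∀ x, |Ψ N x - Ψ₀ x| ≤ κ * χ x) (g : SLR n) :
    Tendsto (fun N : ℕ => (∑' v : Fin k → Fin n → ℤ,
      Ψ N ((N : ℝ)⁻¹ • tupleMulVec g.1 (intTuple v))) /
      (N : ℝ) ^ (k * n)) atTop (𝓝 (∫ x, Ψ₀ x)) := by
  have k1 := tendsto_riemannSum_lattice h₀ h₀c g
  have k2 := tendsto_riemannSum_lattice hχ hχc g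
  set S : ℕ → ℝ := fun N => (∑' v : Fin k → Fin n → ℤ,
      χ ((N : ℝ)⁻¹ • tupleMulVec g.1 (intTuple v))) / (N : ℝ) ^ (k * n) with hS
  set J := ∫ x, χ x
  refine k1.congr_dist ?_
  rw [Metric.tendsto_nhds]
  intro ε hε
  have hJ : 0 < |J| + 1 := by positivity
  have hκ : 0 < ε / (|J| + 1) := by positivity
  have hJS : ∀ᶠ N in atTop, S N < |J| + 1 :=
    k2.eventually_lt_const (lt_of_le_of_lt (le_abs_self J) (lt_add_one _))
  filter_upwards [happ _ hκ, eventually_gt_atTop 0, hΨc, hJS] with N hN hN0 hNc hSN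
  have hc : (N : ℝ)⁻¹ ≠ 0 := inv_ne_zero (by exact_mod_cast hN0.ne')
  have hNpos : (0 : ℝ) < (N : ℝ) ^ (k * n) := by
    have : (0 : ℝ) < N := by exact_mod_cast hN0
    positivity
  rw [Real.dist_eq, sub_zero, abs_of_nonneg dist_nonneg, dist_comm, Real.dist_eq, ← sub_div,
    ← (summable_lattice hNc g hc).tsum_sub (summable_lattice h₀c g hc), abs_div,
    abs_of_pos hNpos]
  have hsum := (summable_lattice hNc g hc).sub (summable_lattice h₀c g hc)
  have hle : |∑' v : Fin k → Fin n → ℤ, (Ψ N ((N : ℝ)⁻¹ • tupleMulVec g.1 (intTuple v)) -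
      Ψ₀ ((N : ℝ)⁻¹ • tupleMulVec g.1 (intTuple v)))| ≤
      ∑' v : Fin k → Fin n → ℤ, ε / (|J| + 1) *
        χ ((N : ℝ)⁻¹ • tupleMulVec g.1 (intTuple v)) :=
    (norm_tsum_le_tsum_norm hsum.norm).trans (hsum.norm.tsum_le_tsum (fun v => hN _)
      ((summable_lattice hχc g hc).mul_left _))
  rw [tsum_mul_left] at hle
  calc _ ≤ (ε / (|J| + 1) * ∑' v : Fin k → Fin n → ℤ,
        χ ((N : ℝ)⁻¹ • tupleMulVec g.1 (intTuple v))) / (N : ℝ) ^ (k * n) := by gcongr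
    _ = ε / (|J| + 1) * S N := by rw [hS]; ring
    _ < ε / (|J| + 1) * (|J| + 1) := by gcongr
    _ = ε := by field_simp

/-- The integrals converge under the same kind of approximation. -/
theorem tendsto_integral_of_approx {Ψ : ℕ → (Fin k → Fin n → ℝ) → ℝ}
    {Ψ₀ χ : (Fin k → Fin n → ℝ) → ℝ} (h₀ : Integrable Ψ₀)
    (hΨc : ∀ᶠ N in atTop, Integrable (Ψ N)) (hχ : Integrable χ)
    (happ : ∀ κ > 0, ∀ᶠ N in atTop, ∀ x, |Ψ N x - Ψ₀ x| ≤ κ * χ x) :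
    Tendsto (fun N : ℕ => ∫ x, Ψ N x) atTop (𝓝 (∫ x, Ψ₀ x)) := by
  rw [Metric.tendsto_nhds]
  intro ε hε
  set J := ∫ x, χ x
  have hκ : 0 < ε / (|J| + 1) := by positivity
  filter_upwards [happ _ hκ, hΨc] with N hN hNi
  rw [Real.dist_eq, ← integral_sub hNi h₀]
  calc |∫ x, (Ψ N x - Ψ₀ x)| ≤ ∫ x, |Ψ N x - Ψ₀ x| := abs_integral_le_integral_abs
    _ ≤ ∫ x, ε / (|J| + 1) * χ x :=
      integral_mono (hNi.sub h₀).abs (hχ.const_mul _) hN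
    _ = ε / (|J| + 1) * J := integral_const_mul _ _
    _ ≤ ε / (|J| + 1) * |J| := by gcongr; exact le_abs_self J
    _ < ε / (|J| + 1) * (|J| + 1) := by gcongr; exact lt_add_one _
    _ = ε := by field_simp

end RiemannSum

/-! ### Averaging over a shear followed by a dilation -/

section Shear

variable {n k : ℕ}

/-- The coordinate vector of the linear form `x ↦ ∑ a, s a * x (e a)`. -/
def shearRow (e : Fin k → Fin n) (s : Fin k → ℝ) : Fin n → ℝ :=
  fun l => ∑ a, if e a = l then s a else 0

theorem shearRow_dotProduct (e : Fin k → Fin n) (s : Fin k → ℝ) (x : Fin n → ℝ) :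
    shearRow e s ⬝ᵥ x = ∑ a, s a * x (e a) := by
  simp only [shearRow, dotProduct, Finset.sum_mul]
  rw [Finset.sum_comm]
  simp [ite_mul]

/-- The matrix of the shear `x j ↦ x j + ∑ a, s a * x (e a)` followed by the diagonal map
multiplying the `j`-th coordinate by `r ^ (n - 1)` and the others by `r⁻¹`. -/
def shearDilationMatrix (r : ℝ) (e : Fin k → Fin n) (j : Fin n) (s : Fin k → ℝ) :
    Matrix (Fin n) (Fin n) ℝ :=
  Matrix.diagonal (fun l => if l = j then r ^ (n - 1) else r⁻¹) *
    (1 + Matrix.replicateCol Unit (Pi.single j (1 : ℝ)) * Matrix.replicateRow Unit (shearRow e s))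

theorem shearDilationMatrix_mulVec (r : ℝ) (e : Fin k → Fin n) (j : Fin n) (s : Fin k → ℝ)
    (x : Fin n → ℝ) :
    (shearDilationMatrix r e j s).mulVec x =
      Function.update (r⁻¹ • x) j (r ^ (n - 1) * (x j + ∑ a, s a * x (e a))) := by
  ext l
  rw [shearDilationMatrix, ← Matrix.mulVec_mulVec, Matrix.mulVec_diagonal, Matrix.add_mulVec,
    Matrix.one_mulVec, ← Matrix.mulVec_mulVec, ← shearRow_dotProduct]
  by_cases hl : l = j
  · subst hl
    simp [Matrix.mulVec, dotProduct, Matrix.mul_apply]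
  · simp [Matrix.mulVec, dotProduct, Matrix.mul_apply, hl]

theorem det_shearDilationMatrix {r : ℝ} (hr : r ≠ 0) {e : Fin k → Fin n} {j : Fin n}
    (hj : ∀ a, e a ≠ j) (s : Fin k → ℝ) : (shearDilationMatrix r e j s).det = 1 := by
  rw [shearDilationMatrix, Matrix.det_mul, Matrix.det_one_add_replicateCol_mul_replicateRow,
    shearRow_dotProduct, Matrix.det_diagonal, Fintype.prod_eq_mul_prod_compl j]
  have h2 : ∏ i ∈ ({j}ᶜ : Finset (Fin n)), (if i = j then r ^ (n - 1) else r⁻¹) =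
      r⁻¹ ^ (n - 1) := by
    rw [Finset.prod_congr rfl (g := fun _ => r⁻¹) fun i hi => by simp at hi; simp [hi]]
    simp [Finset.card_compl]
  rw [h2]
  simp [hj, hr]

theorem continuous_shearDilationMatrix (r : ℝ) (e : Fin k → Fin n) (j : Fin n) :
    Continuous (shearDilationMatrix r e j) := by
  have h : Continuous (shearRow e) := by
    unfold shearRow
    refine continuous_pi fun l => continuous_finsetSum _ fun a _ => ?_
    split_ifs <;> fun_prop
  unfold shearDilationMatrix
  have : Continuous fun s => Matrix.replicateRow Unit (shearRow e s) :=
    continuous_pi fun _ => h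
  fun_prop

/-- `shearDilationMatrix` as an element of `SL(n, ℝ)`. -/
def shearDilation {r : ℝ} (hr : r ≠ 0) {e : Fin k → Fin n} {j : Fin n} (hj : ∀ a, e a ≠ j)
    (s : Fin k → ℝ) : SLR n :=
  ⟨shearDilationMatrix r e j s, det_shearDilationMatrix hr hj s⟩

theorem continuous_shearDilation {r : ℝ} (hr : r ≠ 0) {e : Fin k → Fin n} {j : Fin n}
    (hj : ∀ a, e a ≠ j) : Continuous (shearDilation hr hj) :=
  continuous_induced_rng.2 (continuous_shearDilationMatrix r e j)

/-- The `k × k` submatrix of the coordinates indexed by `e`. -/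
def blockMatrix (e : Fin k → Fin n) (x : Fin k → Fin n → ℝ) : Matrix (Fin k) (Fin k) ℝ :=
  Matrix.of fun i a => x i (e a)

theorem continuous_blockMatrix (e : Fin k → Fin n) : Continuous (blockMatrix e) := by
  unfold blockMatrix
  exact continuous_pi fun i => continuous_pi fun a => by simp only [Matrix.of_apply]; fun_prop

/-- Replace the `j`-th coordinates of a tuple of vectors. -/
def setCol (j : Fin n) (x : Fin k → Fin n → ℝ) (y : Fin k → ℝ) : Fin k → Fin n → ℝ :=
  fun i => Function.update (x i) j (y i)

theorem continuous_setCol {Z : Type*} [TopologicalSpace Z] (j : Fin n)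
    {u : Z → Fin k → Fin n → ℝ} {v : Z → Fin k → ℝ} (hu : Continuous u) (hv : Continuous v) :
    Continuous fun z => setCol j (u z) (v z) := by
  unfold setCol
  fun_prop

theorem blockMatrix_setCol {e : Fin k → Fin n} {j : Fin n} (hj : ∀ a, e a ≠ j)
    (x : Fin k → Fin n → ℝ) (y : Fin k → ℝ) : blockMatrix e (setCol j x y) = blockMatrix e x := by
  ext i a
  simp [blockMatrix, setCol, hj]

theorem norm_le_norm_setCol (j : Fin n) (x : Fin k → Fin n → ℝ) (y : Fin k → ℝ) :
    ‖y‖ ≤ ‖setCol j x y‖ := by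
  refine (pi_norm_le_iff_of_nonneg (norm_nonneg _)).2 fun i => ?_
  have h1 := norm_le_pi_norm (setCol j x y) i
  have h2 := norm_le_pi_norm (setCol j x y i) j
  simp only [setCol, Function.update_self] at h2
  exact h2.trans h1

theorem norm_le_max_setCol (j : Fin n) (x : Fin k → Fin n → ℝ) (y : Fin k → ℝ) :
    ‖x‖ ≤ max ‖setCol j x y‖ ‖fun i => x i j‖ := by
  refine (pi_norm_le_iff_of_nonneg (by positivity)).2 fun i =>
    (pi_norm_le_iff_of_nonneg (by positivity)).2 fun l => ?_
  by_cases hl : l = j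
  · subst hl
    exact (norm_le_pi_norm (fun i => x i l) i).trans (le_max_right _ _)
  · have h1 := norm_le_pi_norm (setCol j x y) i
    have h2 := norm_le_pi_norm (setCol j x y i) l
    simp only [setCol, Function.update_of_ne hl] at h2
    exact (h2.trans h1).trans (le_max_left _ _)

theorem tupleMulVec_shearDilationMatrix {r : ℝ} (hr : r ≠ 0) (e : Fin k → Fin n) (j : Fin n)
    (s : Fin k → ℝ) (x : Fin k → Fin n → ℝ) :
    tupleMulVec (shearDilationMatrix r e j s) x =
      setCol j (r⁻¹ • x) (r ^ n • ((fun i => (r⁻¹ • x) i j) +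
        (blockMatrix e (r⁻¹ • x)).mulVec s)) := by
  have hn : n = n - 1 + 1 := (Nat.succ_pred_eq_of_pos j.pos).symm
  ext1 i
  simp only [tupleMulVec, setCol, shearDilationMatrix_mulVec]
  congr 1
  simp only [Pi.smul_apply, Pi.add_apply, smul_eq_mul, Matrix.mulVec, blockMatrix, dotProduct,
    Matrix.of_apply]
  have h3 : ∑ a, r⁻¹ * x i (e a) * s a = r⁻¹ * ∑ a, s a * x i (e a) := by
    rw [Finset.mul_sum]; exact Finset.sum_congr rfl fun a _ => by ring
  rw [h3, ← mul_add]
  conv_rhs => rw [hn, pow_succ]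
  field_simp

end Shear

section ShearProfile

variable {n k : ℕ}

/-- A smooth probability density on `ℝᵏ` supported in the ball of radius two. -/
def shearWeight (k : ℕ) : (Fin k → ℝ) → ℝ :=
  (⟨1, 2, one_pos, one_lt_two⟩ : ContDiffBump (0 : Fin k → ℝ)).normed volume

theorem continuous_shearWeight (k : ℕ) : Continuous (shearWeight k) :=
  ContDiffBump.continuous_normed _

theorem shearWeight_nonneg (s : Fin k → ℝ) : 0 ≤ shearWeight k s :=
  ContDiffBump.nonneg_normed _ _

theorem norm_lt_of_shearWeight_ne_zero {s : Fin k → ℝ} (h : shearWeight k s ≠ 0) : ‖s‖ < 2 := by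
  have : s ∈ Function.support (shearWeight k) := h
  rw [shearWeight, ContDiffBump.support_normed_eq] at this
  simpa using this

/-- The probability measure with density `shearWeight k`. -/
def shearProb (k : ℕ) : Measure (Fin k → ℝ) :=
  volume.withDensity fun s => ENNReal.ofReal (shearWeight k s)

instance : IsProbabilityMeasure (shearProb k) := by
  refine ⟨?_⟩
  rw [shearProb, withDensity_apply _ MeasurableSet.univ, Measure.restrict_univ,
    ← ofReal_integral_eq_lintegral_ofReal (f := shearWeight k) (ContDiffBump.integrable_normed _)
      (ae_of_all _ shearWeight_nonneg), shearWeight, ContDiffBump.integral_normed,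
    ENNReal.ofReal_one]

/-- A continuous function equal to `d⁻¹` when `δ ≤ |d|`. -/
def regInv (δ d : ℝ) : ℝ := d / max (d ^ 2) (δ ^ 2)

theorem regInv_eq {δ d : ℝ} (hδ : 0 < δ) (hd : δ ≤ |d|) : regInv δ d = d⁻¹ := by
  have h1 : δ ^ 2 ≤ d ^ 2 := by rw [← sq_abs d]; gcongr
  have h2 : d ≠ 0 := abs_pos.1 (hδ.trans_le hd)
  rw [regInv, max_eq_left h1]
  field_simp

theorem continuous_regInv {δ : ℝ} (hδ : 0 < δ) : Continuous (regInv δ) := by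
  unfold regInv
  refine continuous_id.div (by fun_prop) fun d => ?_
  have : 0 < δ ^ 2 := by positivity
  exact (lt_max_of_lt_right this).ne'

/-- A continuous function of `x` and `z` equal to `(blockMatrix e x)⁻¹ z` when the determinant
is at least `δ` in absolute value. -/
def shearSolve (δ : ℝ) (e : Fin k → Fin n) (x : Fin k → Fin n → ℝ) (z : Fin k → ℝ) :
    Fin k → ℝ :=
  (regInv δ (blockMatrix e x).det • (blockMatrix e x).adjugate).mulVec z

theorem continuous_shearSolve {Z : Type*} [TopologicalSpace Z] {δ : ℝ} (hδ : 0 < δ)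
    (e : Fin k → Fin n) {u : Z → Fin k → Fin n → ℝ} {v : Z → Fin k → ℝ} (hu : Continuous u)
    (hv : Continuous v) : Continuous fun z => shearSolve δ e (u z) (v z) := by
  have h1 : Continuous fun z => blockMatrix e (u z) := (continuous_blockMatrix e).comp hu
  have h2 : Continuous fun z =>
      regInv δ (blockMatrix e (u z)).det • (blockMatrix e (u z)).adjugate :=
    ((continuous_regInv hδ).comp h1.matrix_det).smul h1.matrix_adjugate
  exact h2.matrix_mulVec hv

theorem shearSolve_mulVec {δ : ℝ} (hδ : 0 < δ) {e : Fin k → Fin n} {x : Fin k → Fin n → ℝ}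
    (hx : δ ≤ |(blockMatrix e x).det|) (s : Fin k → ℝ) :
    shearSolve δ e x ((blockMatrix e x).mulVec s) = s := by
  have h2 : (blockMatrix e x).det ≠ 0 := abs_pos.1 (hδ.trans_le hx)
  rw [shearSolve, Matrix.mulVec_mulVec, Matrix.smul_mul, Matrix.adjugate_mul, regInv_eq hδ hx,
    smul_smul, inv_mul_cancel₀ h2, one_smul, Matrix.one_mulVec]

theorem mulVec_shearSolve {δ : ℝ} (hδ : 0 < δ) {e : Fin k → Fin n} {x : Fin k → Fin n → ℝ}
    (hx : δ ≤ |(blockMatrix e x).det|) (z : Fin k → ℝ) :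
    (blockMatrix e x).mulVec (shearSolve δ e x z) = z := by
  have h2 : (blockMatrix e x).det ≠ 0 := abs_pos.1 (hδ.trans_le hx)
  rw [shearSolve, Matrix.mulVec_mulVec, Matrix.mul_smul, Matrix.mul_adjugate, regInv_eq hδ hx,
    smul_smul, inv_mul_cancel₀ h2, one_smul, Matrix.one_mulVec]

/-- The average of `h` over the shears of a rescaled tuple, up to normalisation. -/
def shearProfile (δ M : ℝ) (h : (Fin k → Fin n → ℝ) → ℝ) (e : Fin k → Fin n) (j : Fin n)
    (x : Fin k → Fin n → ℝ) (ε : ℝ) : ℝ :=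
  |regInv δ (blockMatrix e x).det| * ∫ y in Metric.closedBall (0 : Fin k → ℝ) M,
    h (setCol j x y) * shearWeight k (shearSolve δ e x (ε • y - fun i => x i j))

theorem continuous_shearProfile {δ M : ℝ} (hδ : 0 < δ) {h : (Fin k → Fin n → ℝ) → ℝ}
    (hh : Continuous h) (e : Fin k → Fin n) (j : Fin n) :
    Continuous fun p : (Fin k → Fin n → ℝ) × ℝ => shearProfile δ M h e j p.1 p.2 := by
  unfold shearProfile
  refine Continuous.mul ?_ ?_
  · exact ((continuous_regInv hδ).comp
      ((continuous_blockMatrix e).comp continuous_fst).matrix_det).abs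
  · refine continuous_parametric_integral_of_continuous (μ := volume) ?_
      (isCompact_closedBall (0 : Fin k → ℝ) M)
    have h1 : Continuous fun q : ((Fin k → Fin n → ℝ) × ℝ) × (Fin k → ℝ) =>
        setCol j q.1.1 q.2 := continuous_setCol j (by fun_prop) (by fun_prop)
    have h2 : Continuous fun q : ((Fin k → Fin n → ℝ) × ℝ) × (Fin k → ℝ) =>
        shearSolve δ e q.1.1 (q.1.2 • q.2 - fun i => q.1.1 i j) :=
      continuous_shearSolve hδ e (by fun_prop) (by fun_prop)
    exact (hh.comp h1).mul ((continuous_shearWeight k).comp h2)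

theorem shearProfile_nonneg {δ M : ℝ} {h : (Fin k → Fin n → ℝ) → ℝ} (hh : ∀ x, 0 ≤ h x)
    (e : Fin k → Fin n) (j : Fin n) (x : Fin k → Fin n → ℝ) (ε : ℝ) :
    0 ≤ shearProfile δ M h e j x ε :=
  mul_nonneg (abs_nonneg _)
    (integral_nonneg fun _ => mul_nonneg (hh _) (shearWeight_nonneg _))

theorem norm_le_of_shearProfile_ne_zero {δ M : ℝ} (hδ : 0 < δ)
    {h : (Fin k → Fin n → ℝ) → ℝ} {e : Fin k → Fin n} {j : Fin n} (hj : ∀ a, e a ≠ j)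
    (hM : ∀ x, h x ≠ 0 → ‖x‖ ≤ M ∧ δ ≤ |(blockMatrix e x).det|)
    {x : Fin k → Fin n → ℝ} {ε : ℝ} (hε : |ε| ≤ 1) (hx : shearProfile δ M h e j x ε ≠ 0) :
    ‖x‖ ≤ M + k * (M * 2) := by
  obtain ⟨y, hy⟩ : ∃ y, h (setCol j x y) *
      shearWeight k (shearSolve δ e x (ε • y - fun i => x i j)) ≠ 0 := by
    by_contra! hcon
    exact hx (by simp [shearProfile, hcon])
  obtain ⟨h1, h2⟩ := mul_ne_zero_iff.1 hy
  obtain ⟨h3, h4⟩ := hM _ h1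
  rw [blockMatrix_setCol hj] at h4
  have h5 := norm_lt_of_shearWeight_ne_zero h2
  set s := shearSolve δ e x (ε • y - fun i => x i j) with hs
  have h6 : (blockMatrix e x).mulVec s = ε • y - fun i => x i j := mulVec_shearSolve hδ h4 _
  have hM0 : 0 ≤ M := (norm_nonneg _).trans h3
  have hy' := (norm_le_norm_setCol j x y).trans h3
  refine (norm_le_max_setCol j x y).trans (max_le (h3.trans ?_) ?_)
  · have : (0 : ℝ) ≤ k * (M * 2) := by positivity
    linarith
  · refine (pi_norm_le_iff_of_nonneg (by positivity)).2 fun i => ?_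
    have h7 : x i j = ε * y i - (blockMatrix e x).mulVec s i := by
      rw [h6]; simp
    have h8 : |(blockMatrix e x).mulVec s i| ≤ k * (M * 2) := by
      calc |(blockMatrix e x).mulVec s i| ≤ ∑ a, |x i (e a) * s a| :=
            Finset.abs_sum_le_sum_abs (fun a => x i (e a) * s a) Finset.univ
        _ ≤ ∑ a : Fin k, M * 2 := by
            refine Finset.sum_le_sum fun a _ => ?_
            rw [abs_mul]
            have h9 := (norm_le_pi_norm (setCol j x y i) (e a)).trans
              ((norm_le_pi_norm (setCol j x y) i).trans h3)
            simp only [setCol, Function.update_of_ne (hj a), Real.norm_eq_abs] at h9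
            have h10 := (norm_le_pi_norm s a).trans h5.le
            rw [Real.norm_eq_abs] at h10
            gcongr
        _ = k * (M * 2) := by simp
    have h11 : |ε * y i| ≤ M := by
      rw [abs_mul]
      have := (norm_le_pi_norm y i).trans hy'
      rw [Real.norm_eq_abs] at this
      calc |ε| * |y i| ≤ 1 * M := by gcongr
        _ = M := one_mul M
    rw [Real.norm_eq_abs, h7]
    exact (abs_sub _ _).trans (add_le_add h11 h8)

theorem lintegral_comp_affine {A : Matrix (Fin k) (Fin k) ℝ} (hA : A.det ≠ 0)
    {c : ℝ} (hc : c ≠ 0) (b : Fin k → ℝ) {G : (Fin k → ℝ) → ℝ≥0∞} (hG : Measurable G) :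
    ∫⁻ s, G (c • (b + A.mulVec s)) = ENNReal.ofReal |(c ^ k * A.det)⁻¹| * ∫⁻ y, G y := by
  have hdet : (c • A).det = c ^ k * A.det := by simp
  have h0 := Real.map_matrix_volume_pi_eq_smul_volume_pi (M := c • A)
    (by rw [hdet]; positivity)
  rw [hdet] at h0
  have h1 : ∀ s, c • (b + A.mulVec s) = c • b + Matrix.toLin' (c • A) s := fun s => by
    simp
  have h2 : Measurable (Matrix.toLin' (c • A)) :=
    (LinearMap.continuous_of_finiteDimensional _).measurable
  simp_rw [h1]
  rw [← lintegral_map (f := fun y => G (c • b + y)) (by fun_prop) h2, h0,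
    lintegral_smul_measure, lintegral_add_left_eq_self, smul_eq_mul]

theorem lintegral_shearProb_setCol {δ M r : ℝ} (hδ : 0 < δ) (hr : 0 < r)
    {h : (Fin k → Fin n → ℝ) → ℝ} (hh : Continuous h) (h0 : ∀ x, 0 ≤ h x)
    {e : Fin k → Fin n} {j : Fin n} (hj : ∀ a, e a ≠ j)
    (hM : ∀ x, h x ≠ 0 → ‖x‖ ≤ M ∧ δ ≤ |(blockMatrix e x).det|)
    (x : Fin k → Fin n → ℝ) :
    ∫⁻ s, ENNReal.ofReal (h (setCol j x (r • ((fun i => x i j) + (blockMatrix e x).mulVec s))))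
      ∂(shearProb k) = ENNReal.ofReal ((r ^ k)⁻¹ * shearProfile δ M h e j x r⁻¹) := by
  have hw : Measurable fun s => ENNReal.ofReal (shearWeight k s) :=
    (continuous_shearWeight k).measurable.ennreal_ofReal
  have hmeas : Measurable fun s : Fin k → ℝ => ENNReal.ofReal
      (h (setCol j x (r • ((fun i => x i j) + (blockMatrix e x).mulVec s)))) := by
    have h1 : Continuous fun s : Fin k → ℝ =>
        setCol j x (r • ((fun i => x i j) + (blockMatrix e x).mulVec s)) :=
      continuous_setCol j continuous_const (by fun_prop)
    exact (hh.comp h1).measurable.ennreal_ofReal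
  by_cases hd : δ ≤ |(blockMatrix e x).det|
  · have hd0 : (blockMatrix e x).det ≠ 0 := abs_pos.1 (hδ.trans_le hd)
    let g : (Fin k → ℝ) → ℝ := fun y =>
      h (setCol j x y) * shearWeight k (shearSolve δ e x (r⁻¹ • y - fun i => x i j))
    have hg : Continuous g := by
      have h1 : Continuous fun y : Fin k → ℝ => setCol j x y :=
        continuous_setCol j continuous_const continuous_id
      have h2 : Continuous fun y : Fin k → ℝ =>
          shearSolve δ e x (r⁻¹ • y - fun i => x i j) :=
        continuous_shearSolve hδ e continuous_const (by fun_prop)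
      exact (hh.comp h1).mul ((continuous_shearWeight k).comp h2)
    have hg0 : ∀ y, 0 ≤ g y := fun y => mul_nonneg (h0 _) (shearWeight_nonneg _)
    have hgM : ∀ y, y ∉ Metric.closedBall (0 : Fin k → ℝ) M → g y = 0 := by
      intro y hy
      by_contra hne
      refine hy ?_
      rw [mem_closedBall_zero_iff]
      exact (norm_le_norm_setCol j x y).trans (hM _ (left_ne_zero_of_mul hne)).1
    have hgi : Integrable g := hg.integrable_of_hasCompactSupport
      (HasCompactSupport.intro (isCompact_closedBall (0 : Fin k → ℝ) M) hgM)
    rw [shearProb, lintegral_withDensity_eq_lintegral_mul _ hw hmeas]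
    have h1 : ∀ s, ((fun s => ENNReal.ofReal (shearWeight k s)) * fun s => ENNReal.ofReal
        (h (setCol j x (r • ((fun i => x i j) + (blockMatrix e x).mulVec s))))) s =
        (fun y => ENNReal.ofReal (g y))
          (r • ((fun i => x i j) + (blockMatrix e x).mulVec s)) := by
      intro s
      simp only [g, Pi.mul_apply]
      rw [smul_smul, inv_mul_cancel₀ hr.ne', one_smul, add_sub_cancel_left,
        shearSolve_mulVec hδ hd, mul_comm (h _), ENNReal.ofReal_mul (shearWeight_nonneg _)]
    rw [lintegral_congr h1, lintegral_comp_affine hd0 hr.ne' _ hg.measurable.ennreal_ofReal,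
      ← ofReal_integral_eq_lintegral_ofReal hgi (ae_of_all _ hg0),
      ← ENNReal.ofReal_mul (abs_nonneg _), ← setIntegral_eq_integral_of_forall_compl_eq_zero hgM,
      shearProfile, regInv_eq hδ hd, mul_inv, abs_mul, mul_assoc,
      abs_of_pos (show 0 < (r ^ k)⁻¹ by positivity)]
  · have hz : ∀ y, h (setCol j x y) = 0 := fun y => by
      by_contra hne
      exact hd (by simpa [blockMatrix_setCol hj] using (hM _ hne).2)
    simp [hz, shearProfile]

end ShearProfile

section MeanValue

variable {n k : ℕ} {δ M : ℝ} {h : (Fin k → Fin n → ℝ) → ℝ} {e : Fin k → Fin n} {j : Fin n}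

theorem lintegral_shearDilation {r : ℝ} (hδ : 0 < δ) (hr : 0 < r) (hh : Continuous h)
    (h0 : ∀ x, 0 ≤ h x) (hj : ∀ a, e a ≠ j)
    (hM : ∀ x, h x ≠ 0 → ‖x‖ ≤ M ∧ δ ≤ |(blockMatrix e x).det|) (x : Fin k → Fin n → ℝ) :
    ∫⁻ s, ENNReal.ofReal (h (tupleMulVec (shearDilationMatrix r e j s) x)) ∂(shearProb k) =
      ENNReal.ofReal ((r ^ (k * n))⁻¹ * shearProfile δ M h e j (r⁻¹ • x) (r ^ n)⁻¹) := by
  simp_rw [tupleMulVec_shearDilationMatrix hr.ne']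
  rw [lintegral_shearProb_setCol hδ (pow_pos hr n) hh h0 hj hM, ← pow_mul, mul_comm n k]

theorem hasCompactSupport_shearProfile (hδ : 0 < δ) (hj : ∀ a, e a ≠ j)
    (hM : ∀ x, h x ≠ 0 → ‖x‖ ≤ M ∧ δ ≤ |(blockMatrix e x).det|) {ε : ℝ} (hε : |ε| ≤ 1) :
    HasCompactSupport fun x => shearProfile δ M h e j x ε :=
  HasCompactSupport.intro (isCompact_closedBall (0 : Fin k → Fin n → ℝ) (M + k * (M * 2)))
    fun x hx => by
      by_contra hne
      exact hx (mem_closedBall_zero_iff.2 (norm_le_of_shearProfile_ne_zero hδ hj hM hε hne))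

theorem continuous_shearProfile_left (hδ : 0 < δ) (hh : Continuous h) (ε : ℝ) :
    Continuous fun x => shearProfile δ M h e j x ε :=
  (continuous_shearProfile hδ hh e j).comp (Continuous.prodMk_left ε)

theorem continuous_tupleMulVec_shearDilationMatrix (r : ℝ) (e : Fin k → Fin n) (j : Fin n) :
    Continuous fun p : (Fin k → Fin n → ℝ) × (Fin k → ℝ) =>
      tupleMulVec (shearDilationMatrix r e j p.2) p.1 :=
  continuous_tupleMulVec.comp
    (((continuous_shearDilationMatrix r e j).comp continuous_snd).prodMk continuous_fst)

theorem integral_shearProfile {r : ℝ} (hδ : 0 < δ) (hr : 1 ≤ r) (hh : Continuous h)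
    (hhc : HasCompactSupport h) (h0 : ∀ x, 0 ≤ h x) (hj : ∀ a, e a ≠ j)
    (hM : ∀ x, h x ≠ 0 → ‖x‖ ≤ M ∧ δ ≤ |(blockMatrix e x).det|) :
    ∫ x, shearProfile δ M h e j x (r ^ n)⁻¹ = ∫ x, h x := by
  have hr0 : 0 < r := one_pos.trans_le hr
  have hε : |(r ^ n)⁻¹| ≤ 1 := by
    rw [abs_of_nonneg (by positivity)]
    exact inv_le_one_of_one_le₀ (one_le_pow₀ hr)
  set Ψ := fun x => shearProfile δ M h e j x (r ^ n)⁻¹ with hΨ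
  have hc : Continuous Ψ := continuous_shearProfile_left hδ hh _
  have hs : HasCompactSupport Ψ := hasCompactSupport_shearProfile hδ hj hM hε
  have h1 : ∫ x, Ψ x = ∫ z, (r ^ (k * n))⁻¹ * Ψ (r⁻¹ • z) := by
    rw [integral_const_mul, Measure.integral_comp_inv_smul]
    simp only [Module.finrank_fintype_fun_eq_card, Module.finrank_pi_fintype, Finset.sum_const,
      Finset.card_univ, Fintype.card_fin, smul_eq_mul]
    rw [abs_of_pos (by positivity), inv_mul_cancel_left₀ (by positivity)]
  have hc' : Continuous fun z => (r ^ (k * n))⁻¹ * Ψ (r⁻¹ • z) := by fun_prop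
  have hi : Integrable fun z => (r ^ (k * n))⁻¹ * Ψ (r⁻¹ • z) :=
    ((hc.integrable_of_hasCompactSupport hs).comp_smul (inv_ne_zero hr0.ne')).const_mul _
  have hnn : ∀ z, 0 ≤ (r ^ (k * n))⁻¹ * Ψ (r⁻¹ • z) := fun z =>
    mul_nonneg (by positivity) (shearProfile_nonneg h0 e j _ _)
  rw [h1, ← ENNReal.ofReal_eq_ofReal_iff (integral_nonneg hnn) (integral_nonneg h0),
    ofReal_integral_eq_lintegral_ofReal hi (ae_of_all _ hnn),
    ofReal_integral_eq_lintegral_ofReal (hh.integrable_of_hasCompactSupport hhc)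
      (ae_of_all _ h0)]
  simp_rw [hΨ, ← lintegral_shearDilation hδ hr0 hh h0 hj hM]
  rw [lintegral_lintegral_swap]
  · have h2 : ∀ s, ∫⁻ x, ENNReal.ofReal (h (tupleMulVec (shearDilationMatrix r e j s) x)) =
        ∫⁻ x, ENNReal.ofReal (h x) := fun s =>
      (volume_preserving_tupleMulVec (shearDilation hr0.ne' hj s)).lintegral_comp
        hh.measurable.ennreal_ofReal
    simp_rw [h2]
    simp
  · exact (hh.comp
      (continuous_tupleMulVec_shearDilationMatrix r e j)).measurable.ennreal_ofReal.aemeasurable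

theorem shearProfile_approx (hδ : 0 < δ) (hh : Continuous h) (hj : ∀ a, e a ≠ j)
    (hM : ∀ x, h x ≠ 0 → ‖x‖ ≤ M ∧ δ ≤ |(blockMatrix e x).det|) {κ : ℝ} (hκ : 0 < κ) :
    ∀ᶠ N : ℕ in atTop, ∀ x,
      |shearProfile δ M h e j x ((N : ℝ) ^ n)⁻¹ - shearProfile δ M h e j x 0| ≤
        κ * max 0 (M + k * (M * 2) + 1 - ‖x‖) := by
  have hK : IsCompact (Metric.closedBall (0 : Fin k → Fin n → ℝ) (M + k * (M * 2)) ×ˢ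
      Set.Icc (-1 : ℝ) 1) := (isCompact_closedBall _ _).prod isCompact_Icc
  have huc := Metric.uniformContinuousOn_iff.1 (hK.uniformContinuousOn_of_continuous
    (continuous_shearProfile (M := M) hδ hh e j).continuousOn) κ hκ
  obtain ⟨η, hη, huc⟩ := huc
  have hlim : Tendsto (fun N : ℕ => ((N : ℝ) ^ n)⁻¹) atTop (𝓝 0) :=
    ((tendsto_pow_atTop j.pos.ne').comp tendsto_natCast_atTop_atTop).inv_tendsto_atTop
  filter_upwards [(Metric.tendsto_nhds.1 hlim) η hη, (Metric.tendsto_nhds.1 hlim) 1 one_pos]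
    with N hN hN1 x
  rw [Real.dist_eq, sub_zero] at hN1
  by_cases hx : ‖x‖ ≤ M + k * (M * 2)
  · have h1 := huc (x, ((N : ℝ) ^ n)⁻¹) ⟨mem_closedBall_zero_iff.2 hx, abs_le.1 hN1.le⟩ (x, 0)
      ⟨mem_closedBall_zero_iff.2 hx, by simp⟩ (by rw [Prod.dist_eq, dist_self]; exact max_lt hη hN)
    rw [Real.dist_eq] at h1
    refine h1.le.trans (le_mul_of_one_le_right hκ.le (le_max_of_le_right ?_))
    linarith
  · have hz : ∀ ε : ℝ, |ε| ≤ 1 → shearProfile δ M h e j x ε = 0 := fun ε hε => by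
      by_contra hne
      exact hx (norm_le_of_shearProfile_ne_zero hδ hj hM hε hne)
    rw [hz _ hN1.le, hz 0 (by simp), sub_zero, abs_zero]
    positivity

theorem lintegral_tupleSum_shearDilation {r : ℝ} (hδ : 0 < δ) (hr : 1 ≤ r) (hr0 : r ≠ 0)
    (hh : Continuous h) (h0 : ∀ x, 0 ≤ h x) (hj : ∀ a, e a ≠ j)
    (hM : ∀ x, h x ≠ 0 → ‖x‖ ≤ M ∧ δ ≤ |(blockMatrix e x).det|) (Γ : SLR n) :
    ∫⁻ s, tupleSum (fun x => ENNReal.ofReal (h x)) (shearDilation hr0 hj s • latticeMk Γ)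
      ∂(shearProb k) =
    ENNReal.ofReal ((∑' v : Fin k → Fin n → ℤ, shearProfile δ M h e j
      (r⁻¹ • tupleMulVec Γ.1 (intTuple v)) (r ^ n)⁻¹) / r ^ (k * n)) := by
  have hrp : 0 < r := one_pos.trans_le hr
  have hε : |(r ^ n)⁻¹| ≤ 1 := by
    rw [abs_of_nonneg (by positivity)]
    exact inv_le_one_of_one_le₀ (one_le_pow₀ hr)
  have h1 : ∀ s : Fin k → ℝ,
      tupleSum (fun x => ENNReal.ofReal (h x)) (shearDilation hr0 hj s • latticeMk Γ) =
      ∑' v : Fin k → Fin n → ℤ, ENNReal.ofReal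
        (h (tupleMulVec (shearDilationMatrix r e j s) (tupleMulVec Γ.1 (intTuple v)))) := by
    intro s
    rw [tupleSum_smul, tupleSum_latticeMk]
    rfl
  simp_rw [h1]
  rw [lintegral_tsum]
  · simp_rw [lintegral_shearDilation hδ hrp hh h0 hj hM]
    rw [← ENNReal.ofReal_tsum_of_nonneg, tsum_mul_left, div_eq_inv_mul]
    · exact fun v => mul_nonneg (by positivity) (shearProfile_nonneg h0 e j _ _)
    · exact (summable_lattice (hasCompactSupport_shearProfile hδ hj hM hε) Γ
        (inv_ne_zero hr0)).mul_left _
  · intro v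
    exact (hh.comp ((continuous_tupleMulVec_shearDilationMatrix r e j).comp
      (Continuous.prodMk_right _))).measurable.ennreal_ofReal.aemeasurable

/-- The mean value theorem for a test function supported on tuples with a nonvanishing minor that
does not involve all coordinates. -/
theorem lintegral_tupleMeasure_eq (μ : Measure (LatticeSpace n)) [IsProbabilityMeasure μ]
    (hinv : ∀ g : SLR n, Measure.map (fun x => g • x) μ = μ)
    (hδ : 0 < δ) (hh : Continuous h) (h0 : ∀ x, 0 ≤ h x) (hj : ∀ a, e a ≠ j)
    (hM : ∀ x, h x ≠ 0 → ‖x‖ ≤ M ∧ δ ≤ |(blockMatrix e x).det|) :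
    ∫⁻ x, ENNReal.ofReal (h x) ∂(tupleMeasure k μ) = ∫⁻ x, ENNReal.ofReal (h x) := by
  have hhc : HasCompactSupport h :=
    HasCompactSupport.intro (isCompact_closedBall (0 : Fin k → Fin n → ℝ) M) fun x hx => by
      by_contra hne
      exact hx (mem_closedBall_zero_iff.2 (hM x hne).1)
  set B := M + k * (M * 2)
  have hχ : Continuous fun x : Fin k → Fin n → ℝ => max 0 (B + 1 - ‖x‖) := by fun_prop
  have hχc : HasCompactSupport fun x : Fin k → Fin n → ℝ => max 0 (B + 1 - ‖x‖) :=
    HasCompactSupport.intro (isCompact_closedBall (0 : Fin k → Fin n → ℝ) (B + 1))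
      fun x hx => by
        rw [mem_closedBall_zero_iff, not_le] at hx
        exact max_eq_left (by linarith)
  have hε : ∀ N : ℕ, 1 ≤ N → |((N : ℝ) ^ n)⁻¹| ≤ 1 := fun N hN => by
    rw [abs_of_nonneg (by positivity)]
    exact inv_le_one_of_one_le₀ (one_le_pow₀ (by exact_mod_cast hN))
  have hcs : ∀ᶠ N : ℕ in atTop,
      HasCompactSupport fun x => shearProfile δ M h e j x ((N : ℝ) ^ n)⁻¹ := by
    filter_upwards [eventually_ge_atTop 1] with N hN
    exact hasCompactSupport_shearProfile hδ hj hM (hε N hN)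
  have h₀ : Continuous fun x => shearProfile δ M h e j x 0 :=
    continuous_shearProfile_left hδ hh 0
  have h₀c : HasCompactSupport fun x => shearProfile δ M h e j x 0 :=
    hasCompactSupport_shearProfile hδ hj hM (by simp)
  have h_int : ∫ x, shearProfile δ M h e j x 0 = ∫ x, h x := by
    have h1 := tendsto_integral_of_approx
      (Ψ := fun (N : ℕ) x => shearProfile δ M h e j x ((N : ℝ) ^ n)⁻¹)
      (h₀.integrable_of_hasCompactSupport h₀c)
      (hcs.mono fun N hN =>
        (continuous_shearProfile_left hδ hh _).integrable_of_hasCompactSupport hN)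
      (hχ.integrable_of_hasCompactSupport hχc)
      (fun κ hκ => shearProfile_approx hδ hh hj hM hκ)
    refine tendsto_nhds_unique h1 (tendsto_const_nhds.congr' ?_)
    filter_upwards [eventually_ge_atTop 1] with N hN
    exact (integral_shearProfile hδ (by exact_mod_cast hN) hh hhc h0 hj hM).symm
  have hpos : ∀ N : ℕ, ((max N 1 : ℕ) : ℝ) ≠ 0 := fun N => by
    have : 0 < max N 1 := by positivity
    positivity
  rw [lintegral_tupleMeasure μ hh.measurable.ennreal_ofReal]
  refine lintegral_eq_of_tendsto_average μ hinv
    (measurable_tupleSum hh.measurable.ennreal_ofReal) (shearProb k)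
    (fun N s => shearDilation (hpos N) hj s) (fun N => ?_) fun L => ?_
  · have : Continuous fun p : (Fin k → ℝ) × LatticeSpace n =>
        shearDilation (hpos N) hj p.1 • p.2 :=
      ((continuous_shearDilation (hpos N) hj).comp continuous_fst).smul continuous_snd
    exact this.measurable
  · obtain ⟨Γ, rfl⟩ := latticeMk_surjective L
    rw [← ofReal_integral_eq_lintegral_ofReal (hh.integrable_of_hasCompactSupport hhc)
      (ae_of_all _ h0), ← h_int]
    refine (ENNReal.tendsto_ofReal (tendsto_riemannSum_of_approx
      (Ψ := fun (N : ℕ) x => shearProfile δ M h e j x ((N : ℝ) ^ n)⁻¹) h₀ h₀c hcs hχ hχc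
      (fun κ hκ => shearProfile_approx hδ hh hj hM hκ) Γ)).congr' ?_
    filter_upwards [eventually_ge_atTop 1] with N hN
    rw [lintegral_tupleSum_shearDilation hδ (by exact_mod_cast le_max_right _ _) (hpos N) hh h0 hj
      hM Γ, max_eq_left hN]

end MeanValue

section Siegel

variable {n k : ℕ}

theorem exists_blockMatrix_det_ne_zero {x : Fin k → Fin n → ℝ} (hx : LinearIndependent ℝ x) :
    ∃ e : Fin k → Fin n, (blockMatrix e x).det ≠ 0 := by
  have h1 := LinearIndependent.rank_matrix (M := Matrix.of x) hx
  rw [Matrix.rank_eq_finrank_span_cols, Fintype.card_fin] at h1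
  obtain ⟨f, hf, -, hli⟩ := Submodule.exists_fun_fin_finrank_span_eq ℝ
    (Set.range (Matrix.of x).col)
  choose e he using hf
  refine ⟨fun a => e (Fin.cast h1.symm a), ?_⟩
  rw [← isUnit_iff_ne_zero, ← Matrix.isUnit_iff_isUnit_det,
    ← Matrix.linearIndependent_cols_iff_isUnit]
  have h2 : (blockMatrix (fun a => e (Fin.cast h1.symm a)) x).col =
      f ∘ Fin.cast h1.symm := by
    funext a
    rw [Function.comp_apply, ← he]
    rfl
  rw [h2]
  exact hli.comp _ (Fin.cast_injective _)

theorem exists_forall_ne (hk : k < n) (e : Fin k → Fin n) : ∃ j, ∀ a, e a ≠ j := by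
  by_contra! h
  have := Fintype.card_le_of_surjective e h
  simp at this
  omega

/-- A continuous cutoff, positive on tuples with `blockMatrix e` well-conditioned. -/
def minorCutoff (e : Fin k → Fin n) (m : ℕ) (x : Fin k → Fin n → ℝ) : ℝ :=
  max 0 (|(blockMatrix e x).det| - ((m : ℝ) + 1)⁻¹) * max 0 ((m : ℝ) + 1 - ‖x‖)

theorem continuous_minorCutoff (e : Fin k → Fin n) (m : ℕ) : Continuous (minorCutoff e m) := by
  have := (continuous_blockMatrix e).matrix_det
  unfold minorCutoff
  fun_prop

theorem minorCutoff_nonneg (e : Fin k → Fin n) (m : ℕ) (x : Fin k → Fin n → ℝ) :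
    0 ≤ minorCutoff e m x := by unfold minorCutoff; positivity

theorem minorCutoff_ne_zero {e : Fin k → Fin n} {m : ℕ} {x : Fin k → Fin n → ℝ}
    (h : minorCutoff e m x ≠ 0) :
    ‖x‖ ≤ (m : ℝ) + 1 ∧ ((m : ℝ) + 1)⁻¹ ≤ |(blockMatrix e x).det| := by
  obtain ⟨h1, h2⟩ := mul_ne_zero_iff.1 h
  refine ⟨?_, ?_⟩
  · by_contra! hlt
    exact h2 (max_eq_left (by linarith))
  · by_contra! hlt
    exact h1 (max_eq_left (by linarith))

theorem exists_minorCutoff_pos {e : Fin k → Fin n} {x : Fin k → Fin n → ℝ}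
    (h : (blockMatrix e x).det ≠ 0) : ∃ m, 0 < minorCutoff e m x := by
  obtain ⟨a, ha⟩ := exists_nat_one_div_lt (abs_pos.2 h)
  obtain ⟨b, hb⟩ := exists_nat_gt ‖x‖
  refine ⟨max a b, mul_pos (lt_max_of_lt_right ?_) (lt_max_of_lt_right ?_)⟩
  · have : (((max a b : ℕ) : ℝ) + 1)⁻¹ ≤ 1 / ((a : ℝ) + 1) := by
      rw [one_div]
      gcongr
      exact le_max_left _ _
    linarith
  · have : (b : ℝ) ≤ ((max a b : ℕ) : ℝ) := by exact_mod_cast le_max_right a b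
    linarith

variable (μ : Measure (LatticeSpace n)) [IsProbabilityMeasure μ]

theorem withDensity_minorCutoff_eq
    (hinv : ∀ g : SLR n, Measure.map (fun x => g • x) μ = μ) {e : Fin k → Fin n} {j : Fin n}
    (hj : ∀ a, e a ≠ j) (m : ℕ) :
    (tupleMeasure k μ).withDensity (fun x => ENNReal.ofReal (minorCutoff e m x)) =
      volume.withDensity fun x => ENNReal.ofReal (minorCutoff e m x) := by
  have hρ := continuous_minorCutoff e m
  have key : ∀ f : BoundedContinuousFunction (Fin k → Fin n → ℝ) NNReal,
      ∫⁻ x, f x ∂((tupleMeasure k μ).withDensity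
        (fun x => ENNReal.ofReal (minorCutoff e m x))) =
      ∫⁻ x, f x ∂(volume.withDensity fun x => ENNReal.ofReal (minorCutoff e m x)) := by
    intro f
    have hf : Measurable fun x => (f x : ℝ≥0∞) := f.continuous.measurable.coe_nnreal_ennreal
    rw [lintegral_withDensity_eq_lintegral_mul _ hρ.measurable.ennreal_ofReal hf,
      lintegral_withDensity_eq_lintegral_mul _ hρ.measurable.ennreal_ofReal hf]
    have h1 : ∀ x, ((fun x => ENNReal.ofReal (minorCutoff e m x)) * fun x => (f x : ℝ≥0∞)) x =
        ENNReal.ofReal (minorCutoff e m x * (f x : ℝ)) := fun x => by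
      rw [Pi.mul_apply, ENNReal.ofReal_mul (minorCutoff_nonneg e m x), ENNReal.ofReal_coe_nnreal]
    simp_rw [h1]
    have hc : Continuous fun x => minorCutoff e m x * (f x : ℝ) :=
      hρ.mul (NNReal.continuous_coe.comp f.continuous)
    exact lintegral_tupleMeasure_eq μ hinv (δ := ((m : ℝ) + 1)⁻¹) (by positivity) hc
      (fun x => mul_nonneg (minorCutoff_nonneg e m x) (f x).coe_nonneg) hj
      fun x hx => minorCutoff_ne_zero (left_ne_zero_of_mul hx)
  have hfin : IsFiniteMeasure
      (volume.withDensity fun x => ENNReal.ofReal (minorCutoff e m x)) := by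
    refine isFiniteMeasure_withDensity_ofReal (Integrable.hasFiniteIntegral ?_)
    refine hρ.integrable_of_hasCompactSupport (HasCompactSupport.intro
      (isCompact_closedBall (0 : Fin k → Fin n → ℝ) ((m : ℝ) + 1)) fun x hx => ?_)
    by_contra hne
    exact hx (mem_closedBall_zero_iff.2 (minorCutoff_ne_zero hne).1)
  exact (ext_of_forall_lintegral_eq_of_IsFiniteMeasure fun f => (key f).symm).symm

theorem restrict_minorCutoff_eq
    (hinv : ∀ g : SLR n, Measure.map (fun x => g • x) μ = μ) {e : Fin k → Fin n} {j : Fin n}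
    (hj : ∀ a, e a ≠ j) (m : ℕ) :
    (tupleMeasure k μ).restrict {x | 0 < minorCutoff e m x} =
      volume.restrict {x | 0 < minorCutoff e m x} := by
  have hρ := continuous_minorCutoff e m
  have hU : MeasurableSet {x | 0 < minorCutoff e m x} :=
    (isOpen_lt continuous_const hρ).measurableSet
  have key : ∀ (ν : Measure (Fin k → Fin n → ℝ)) {s : Set (Fin k → Fin n → ℝ)},
      MeasurableSet s → ν.restrict {x | 0 < minorCutoff e m x} s =
      ∫⁻ x, (s ∩ {x | 0 < minorCutoff e m x}).indicator
        (fun x => (ENNReal.ofReal (minorCutoff e m x))⁻¹) x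
        ∂(ν.withDensity (fun x => ENNReal.ofReal (minorCutoff e m x))) := by
    intro ν s hs
    have hg : Measurable fun x => (ENNReal.ofReal (minorCutoff e m x))⁻¹ :=
      hρ.measurable.ennreal_ofReal.inv
    rw [lintegral_withDensity_eq_lintegral_mul _ hρ.measurable.ennreal_ofReal
      (hg.indicator (hs.inter hU)), Measure.restrict_apply hs,
      ← lintegral_indicator_one (hs.inter hU)]
    refine lintegral_congr fun x => ?_
    by_cases hx : x ∈ s ∩ {x | 0 < minorCutoff e m x}
    · simp only [Pi.mul_apply, Set.indicator_of_mem hx, Pi.one_apply]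
      exact (ENNReal.mul_inv_cancel (ENNReal.ofReal_pos.2 hx.2).ne' ENNReal.ofReal_ne_top).symm
    · simp [Set.indicator_of_notMem hx]
  ext s hs
  rw [key _ hs, key _ hs, withDensity_minorCutoff_eq μ hinv hj m]

/-- The mean value theorem for sums over linearly independent tuples of lattice vectors. -/
theorem lintegral_tupleSum_eq
    (hinv : ∀ g : SLR n, Measure.map (fun x => g • x) μ = μ) (hk : k < n)
    {h : (Fin k → Fin n → ℝ) → ℝ≥0∞} (hh : Measurable h)
    (h0 : ∀ x, ¬ LinearIndependent ℝ x → h x = 0) :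
    ∫⁻ L, tupleSum h L ∂μ = ∫⁻ x, h x := by
  let U : {p : (Fin k → Fin n) × Fin n // ∀ a, p.1 a ≠ p.2} × ℕ → Set (Fin k → Fin n → ℝ) :=
    fun p => {x | 0 < minorCutoff p.1.1.1 p.2 x}
  have hU : (tupleMeasure k μ).restrict (⋃ p, U p) = volume.restrict (⋃ p, U p) :=
    Measure.restrict_iUnion_congr.2 fun p => restrict_minorCutoff_eq μ hinv p.1.2 p.2
  have hUm : MeasurableSet (⋃ p, U p) := MeasurableSet.iUnion fun p =>
    (isOpen_lt continuous_const (continuous_minorCutoff _ _)).measurableSet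
  have hsub : ∀ x, x ∉ (⋃ p, U p) → h x = 0 := by
    refine fun x hx => h0 x fun hli => hx ?_
    obtain ⟨e, he⟩ := exists_blockMatrix_det_ne_zero hli
    obtain ⟨j, hj⟩ := exists_forall_ne hk e
    obtain ⟨m, hm⟩ := exists_minorCutoff_pos he
    exact Set.mem_iUnion.2 ⟨(⟨(e, j), hj⟩, m), hm⟩
  have hr : ∀ ν : Measure (Fin k → Fin n → ℝ), ∫⁻ x, h x ∂ν = ∫⁻ x in ⋃ p, U p, h x ∂ν := by
    intro ν
    rw [← lintegral_indicator hUm]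
    refine lintegral_congr fun x => ?_
    by_cases hx : x ∈ ⋃ p, U p
    · rw [Set.indicator_of_mem hx]
    · rw [Set.indicator_of_notMem hx, hsub x hx]
  rw [← lintegral_tupleMeasure μ hh, hr, hU, ← hr]

theorem isOpen_setOf_linearIndependent_tuple :
    IsOpen {x : Fin k → Fin n → ℝ | LinearIndependent ℝ x} :=
  isOpen_setOfPred_linearIndependent

/-- Almost every `k`-tuple of vectors is linearly independent. -/
theorem ae_linearIndependent (hk : k ≤ n) :
    ∀ᵐ x : Fin k → Fin n → ℝ, LinearIndependent ℝ x := by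
  induction k with
  | zero => exact ae_of_all _ fun x => linearIndependent_empty_type
  | succ k ih =>
    have hD : MeasurableSet {x : Fin (k + 1) → Fin n → ℝ | ¬ LinearIndependent ℝ x} :=
      isOpen_setOf_linearIndependent_tuple.measurableSet.compl
    have hmp := ((volume_preserving_piFinSuccAbove (fun _ : Fin (k + 1) => Fin n → ℝ) 0).symm).comp
      (Measure.measurePreserving_swap (μ := (volume : Measure (Fin k → Fin n → ℝ)))
        (ν := (volume : Measure (Fin n → ℝ))))
    rw [ae_iff, ← hmp.measure_preimage hD.nullMeasurableSet,
      Measure.measure_prod_null (hmp.measurable hD)]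
    filter_upwards [ih (by omega)] with t ht
    have h1 : (Prod.mk t ⁻¹' ((⇑(MeasurableEquiv.piFinSuccAbove
        (fun _ : Fin (k + 1) => Fin n → ℝ) 0).symm ∘ Prod.swap) ⁻¹'
        {x : Fin (k + 1) → Fin n → ℝ | ¬ LinearIndependent ℝ x})) ⊆
        (Submodule.span ℝ (Set.range t) : Set (Fin n → ℝ)) := by
      intro y hy
      by_contra hys
      refine hy ?_
      change LinearIndependent ℝ (Fin.insertNth 0 y t : Fin (k + 1) → Fin n → ℝ)
      rw [Fin.insertNth_zero', linearIndependent_finCons]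
      exact ⟨ht, hys⟩
    refine measure_mono_null h1 (Measure.addHaar_submodule _ _ fun htop => ?_)
    have h2 := finrank_range_le_card (R := ℝ) t
    rw [Set.finrank, htop, finrank_top] at h2
    simp at h2
    omega

end Siegel

section Enumeration

open scoped Nat

/-- The enumerations of a set by `Fin k` correspond to bijections. -/
def enumerationEquiv {β : Type*} (k : ℕ) (X : Set β) :
    {v : Fin k → β // Function.Injective v ∧ Set.range v = X} ≃ (Fin k ≃ X) where
  toFun v := (Equiv.ofInjective v.1 v.2.1).trans (Equiv.setCongr v.2.2)
  invFun E := ⟨fun i => E i, Subtype.val_injective.comp E.injective, by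
    ext x
    constructor
    · rintro ⟨i, rfl⟩
      exact (E i).2
    · exact fun hx => ⟨E.symm ⟨x, hx⟩, by simp⟩⟩
  left_inv v := by ext; simp
  right_inv E := by ext; simp

theorem ncard_enumerations {β : Type*} {k : ℕ} {X : Set β} (hX : X.Finite) (hk : X.ncard = k) :
    {v : Fin k → β | Function.Injective v ∧ Set.range v = X}.ncard = k ! := by
  classical
  have := hX.fintype
  have h1 : Fintype.card X = k := by rw [← hk, Set.ncard_eq_toFinset_card', Set.toFinset_card]
  let E : Fin k ≃ X := (finCongr h1.symm).trans (Fintype.equivFin X).symm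
  rw [← Nat.card_coe_set_eq]
  refine (Nat.card_congr (enumerationEquiv k X)).trans ?_
  rw [Nat.card_eq_fintype_card, Fintype.card_equiv E, Fintype.card_fin]

open scoped Classical in
/-- A sum over finite sets of bounded size as a weighted sum over injective tuples. -/
theorem finsum_set_eq_sum_tuples {β : Type*} {n : ℕ} {F : Set β → ℝ}
    (hF : ∀ X, F X ≠ 0 → X.Finite ∧ X.ncard < n)
    (hfin : ∀ k < n, {v : Fin k → β | Function.Injective v ∧ F (Set.range v) ≠ 0}.Finite) :
    ∑ᶠ X, F X = ∑ k ∈ Finset.range n, (k ! : ℝ)⁻¹ *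
      ∑ᶠ v : Fin k → β, if Function.Injective v then F (Set.range v) else 0 := by
  have hncard : ∀ {k : ℕ} {v : Fin k → β}, Function.Injective v → (Set.range v).ncard = k := by
    intro k v hv
    rw [← Nat.card_coe_set_eq, Nat.card_range_of_injective hv, Nat.card_eq_fintype_card,
      Fintype.card_fin]
  have hs : (Function.support F).Finite := by
    refine (Set.Finite.biUnion (Finset.range n).finite_toSet (t := fun k => Set.range ''
      {v : Fin k → β | Function.Injective v ∧ F (Set.range v) ≠ 0}) fun k hk =>
        (hfin k (by simpa using hk)).image _).subset fun X hX => ?_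
    obtain ⟨h1, h2⟩ := hF X hX
    have : {v : Fin X.ncard → β | Function.Injective v ∧ Set.range v = X}.Nonempty := by
      refine Set.nonempty_of_ncard_ne_zero ?_
      rw [ncard_enumerations h1 rfl]
      positivity
    obtain ⟨v, hv1, hv2⟩ := this
    exact Set.mem_biUnion (by simpa using h2) ⟨v, ⟨hv1, by rwa [hv2]⟩, hv2⟩
  rw [finsum_eq_sum F hs, ← Finset.sum_fiberwise_of_maps_to (t := Finset.range n)
    (g := Set.ncard) fun X hX => by
      rw [Finset.mem_range]; exact (hF X (by simpa using hX)).2]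
  refine Finset.sum_congr rfl fun k hk => ?_
  have hV := hfin k (by simpa using hk)
  rw [finsum_eq_sum_of_support_subset (s := hV.toFinset) _ fun v hv => by
      simp only [Function.mem_support, ne_eq, ite_eq_right_iff, Classical.not_imp] at hv
      simpa using hv,
    ← Finset.sum_fiberwise_of_maps_to (t := hs.toFinset.filter fun X => X.ncard = k)
      (g := Set.range) fun v hv => by
        obtain ⟨h1, h2⟩ := hV.mem_toFinset.1 hv
        simp [h2, hncard h1],
    Finset.mul_sum]
  refine Finset.sum_congr rfl fun X hX => ?_
  obtain ⟨hX1, hX2⟩ := Finset.mem_filter.1 hX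
  have hX3 : F X ≠ 0 := by simpa using hX1
  have h1 : (hV.toFinset.filter fun v => Set.range v = X).card = k ! := by
    rw [← ncard_enumerations (hF X hX3).1 hX2, ← Set.ncard_coe_finset]
    congr 1
    ext v
    simp only [Finset.coe_filter, Set.Finite.mem_toFinset, Set.mem_ofPred_eq]
    constructor
    · exact fun h => ⟨h.1.1, h.2⟩
    · exact fun h => ⟨⟨h.1, by rwa [h.2]⟩, h.2⟩
  rw [Finset.sum_congr rfl (g := fun _ => F X) fun v hv => by
    obtain ⟨h2, h3⟩ := Finset.mem_filter.1 hv
    rw [if_pos (hV.mem_toFinset.1 h2).1, h3], Finset.sum_const, h1, nsmul_eq_mul,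
    inv_mul_cancel_left₀ (by positivity)]

end Enumeration

section Poisson

open scoped Nat

theorem map_comp_injective {E : Type*} [MeasurableSpace E] {ν : Measure E} [IsFiniteMeasure ν]
    {m k : ℕ} {σ : Fin k → Fin m} (hσ : Function.Injective σ) :
    Measure.map (fun x : Fin m → E => x ∘ σ) (Measure.pi fun _ => ν) =
      (ν Set.univ) ^ (m - k) • Measure.pi fun _ : Fin k => ν := by
  have hm : Measurable fun x : Fin m → E => x ∘ σ :=
    measurable_pi_lambda _ fun i => measurable_pi_apply (σ i)
  have h1 : ∀ s : Fin k → Set E, (∀ i, MeasurableSet (s i)) →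
      Measure.map (fun x : Fin m → E => x ∘ σ) (Measure.pi fun _ => ν) (Set.univ.pi s) =
      (ν Set.univ) ^ (m - k) * ∏ i, ν (s i) := by
    intro s hs
    rw [Measure.map_apply hm (MeasurableSet.univ_pi hs)]
    have h2 : (fun x : Fin m → E => x ∘ σ) ⁻¹' (Set.univ.pi s) =
        Set.univ.pi (Function.extend σ s fun _ => Set.univ) := by
      ext x
      simp only [Set.mem_preimage, Set.mem_univ_pi, Function.comp_apply]
      constructor
      · intro h l
        by_cases hl : ∃ i, σ i = l
        · obtain ⟨i, rfl⟩ := hl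
          rw [hσ.extend_apply]
          exact h i
        · rw [Function.extend_apply' _ _ _ hl]
          trivial
      · intro h i
        have := h (σ i)
        rwa [hσ.extend_apply] at this
    rw [h2, Measure.pi_pi, ← Finset.prod_mul_prod_compl (Finset.univ.image σ),
      Finset.prod_image hσ.injOn, mul_comm]
    congr 1
    · rw [Finset.prod_congr rfl (g := fun _ => ν Set.univ) fun l hl => by
        rw [Function.extend_apply' _ _ _ (by simpa using hl)], Finset.prod_const,
        Finset.card_compl, Finset.card_image_of_injective _ hσ]
      simp
    · exact Finset.prod_congr rfl fun i _ => by rw [hσ.extend_apply]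
  refine ext_of_generate_finite
    (Set.pi Set.univ '' Set.pi Set.univ fun _ : Fin k => {s : Set E | MeasurableSet s})
    generateFrom_pi.symm isPiSystem_pi ?_ ?_
  · rintro _ ⟨s, hs, rfl⟩
    rw [h1 s fun i => hs i trivial, Measure.smul_apply, Measure.pi_pi, smul_eq_mul]
  · have := h1 (fun _ => Set.univ) fun _ => MeasurableSet.univ
    rw [Set.pi_univ] at this
    rw [this, Measure.smul_apply, Measure.pi_univ, smul_eq_mul]

variable {n : ℕ} {S : Set (Fin n → ℝ)}

theorem volume_restrict_pi {m : ℕ} :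
    (volume : Measure (Fin m → Fin n → ℝ)).restrict (Set.univ.pi fun _ => S) =
      Measure.pi fun _ => (volume : Measure (Fin n → ℝ)).restrict S :=
  Measure.restrict_pi_pi _ _

theorem setIntegral_comp_injective (hS : volume S < ⊤) {m k : ℕ} {σ : Fin k → Fin m}
    (hσ : Function.Injective σ) {G : (Fin k → Fin n → ℝ) → ℝ} (hG : Measurable G) :
    ∫ x in Set.univ.pi (fun _ : Fin m => S), G (x ∘ σ) =
      (volume S).toReal ^ (m - k) * ∫ x in Set.univ.pi (fun _ : Fin k => S), G x := by
  have : IsFiniteMeasure ((volume : Measure (Fin n → ℝ)).restrict S) := ⟨by simpa using hS⟩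
  have hm : Measurable fun x : Fin m → Fin n → ℝ => x ∘ σ :=
    measurable_pi_lambda _ fun i => measurable_pi_apply (σ i)
  rw [volume_restrict_pi, volume_restrict_pi,
    ← integral_map (f := G) hm.aemeasurable hG.aestronglyMeasurable, map_comp_injective hσ,
    integral_smul_measure]
  simp

theorem ae_injective (hn : 1 ≤ n) (m : ℕ) :
    ∀ᵐ x : Fin m → Fin n → ℝ, Function.Injective x := by
  have h1 : ∀ p : {p : Fin m × Fin m // p.1 ≠ p.2}, ∀ᵐ x : Fin m → Fin n → ℝ,
      x p.1.1 ≠ x p.1.2 := by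
    rintro ⟨⟨i, j⟩, hij⟩
    let ψ : (Fin m → Fin n → ℝ) →ₗ[ℝ] (Fin n → ℝ) :=
      (LinearMap.proj i : (Fin m → Fin n → ℝ) →ₗ[ℝ] (Fin n → ℝ)) - LinearMap.proj j
    have h2 : volume (LinearMap.ker ψ : Set (Fin m → Fin n → ℝ)) = 0 := by
      refine Measure.addHaar_submodule _ _ fun htop => ?_
      have h3 : Pi.single i (fun _ => (1 : ℝ)) ∈ LinearMap.ker ψ := htop ▸ Submodule.mem_top
      have h4 := congrFun (LinearMap.mem_ker.1 h3) ⟨0, hn⟩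
      simp [ψ, Pi.single_eq_of_ne (Ne.symm hij)] at h4
    rw [ae_iff]
    refine measure_mono_null (fun x hx => ?_) h2
    simp only [ne_eq, not_not, Set.mem_ofPred_eq] at hx
    simp [ψ, hx]
  filter_upwards [ae_all_iff.2 h1] with x hx i j hij
  by_contra hne
  exact hx ⟨(i, j), hne⟩ hij

theorem card_filter_injective (k m : ℕ)
    [DecidablePred (Function.Injective (α := Fin k) (β := Fin m))] :
    (Finset.univ.filter fun σ : Fin k → Fin m => Function.Injective σ).card =
      m.descFactorial k := by
  rw [← Fintype.card_subtype, Fintype.card_congr (Equiv.subtypeInjectiveEquivEmbedding _ _),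
    Fintype.card_embedding_eq, Fintype.card_fin, Fintype.card_fin]

theorem hasSum_descFactorial (k : ℕ) (t : ℝ) :
    HasSum (fun m : ℕ => (m.descFactorial k : ℝ) / m ! * t ^ (m - k)) (Real.exp t) := by
  have h1 : HasSum ((fun m : ℕ => (m.descFactorial k : ℝ) / m ! * t ^ (m - k)) ∘ fun i => i + k)
      (Real.exp t) := by
    have h2 := NormedSpace.expSeries_div_hasSum_exp t
    rw [← Real.exp_eq_exp_ℝ] at h2
    refine h2.congr_fun fun i => ?_
    have h3 : ((i + k).descFactorial k : ℝ) * (i ! : ℝ) = (i + k)! := by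
      have := Nat.factorial_mul_descFactorial (n := i + k) (k := k) (by omega)
      rw [Nat.add_sub_cancel] at this
      rw [← this]
      push_cast
      ring
    simp only [Function.comp_apply, Nat.add_sub_cancel]
    rw [← h3]
    have h4 : ((i + k).descFactorial k : ℝ) ≠ 0 := by
      rw [Nat.cast_ne_zero, ne_eq, Nat.descFactorial_eq_zero_iff_lt]
      omega
    field_simp
  refine ((add_left_injective k).hasSum_iff fun m hm => ?_).1 h1
  have : m < k := by
    by_contra! hle
    exact hm ⟨m - k, by simp; omega⟩
  simp [Nat.descFactorial_of_lt this]

variable {f : Set (Fin n → ℝ) → ℝ}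

open scoped Classical in
theorem finsum_subset_range (hsupp : ∀ X : Set (Fin n → ℝ), n ≤ X.ncard → f X = 0)
    {m : ℕ} {x : Fin m → Fin n → ℝ} (hx : Function.Injective x) :
    ∑ᶠ X ∈ {Y : Set (Fin n → ℝ) | Y ⊆ Set.range x}, f X =
      ∑ k ∈ Finset.range n, (k ! : ℝ)⁻¹ *
        ∑ σ : Fin k → Fin m, if Function.Injective σ then f (Set.range (x ∘ σ)) else 0 := by
  have h1 : {Y : Set (Fin n → ℝ) | Y ⊆ Set.range x} = Set.range (Set.image x) := by
    ext Y
    exact Set.subset_range_iff_exists_image_eq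
  rw [h1, finsum_mem_range hx.image_injective, finsum_set_eq_sum_tuples (n := n)
    (fun X hX => ⟨X.toFinite, ?_⟩) fun k _ => Set.toFinite _]
  · refine Finset.sum_congr rfl fun k _ => ?_
    rw [finsum_eq_sum_of_fintype]
    refine congrArg _ (Finset.sum_congr rfl fun σ _ => ?_)
    by_cases h : Function.Injective σ <;> simp [h, Set.range_comp]
  · by_contra! hle
    refine hX (hsupp _ ?_)
    rwa [Set.ncard_image_of_injective _ hx]

theorem setIntegral_finsum_subset_range (hn : 1 ≤ n) (hSfin : volume S < ⊤)
    (hbdd : ∃ M : ℝ, ∀ X, |f X| ≤ M)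
    (hmeas : ∀ m : ℕ, Measurable fun x : Fin m → (Fin n → ℝ) => f (Set.range x))
    (hsupp : ∀ X : Set (Fin n → ℝ), n ≤ X.ncard → f X = 0) (m : ℕ) :
    ∫ x in Set.univ.pi (fun _ : Fin m => S),
      ∑ᶠ X ∈ {Y : Set (Fin n → ℝ) | Y ⊆ Set.range x}, f X =
    ∑ k ∈ Finset.range n, (k ! : ℝ)⁻¹ * (m.descFactorial k * ((volume S).toReal ^ (m - k) *
      ∫ x in Set.univ.pi (fun _ : Fin k => S), f (Set.range x))) := by
  classical
  obtain ⟨M, hM⟩ := hbdd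
  have hfinm : volume (Set.univ.pi fun _ : Fin m => S) < ⊤ := by
    rw [volume_pi_pi]
    exact ENNReal.prod_lt_top fun _ _ => hSfin
  have h_int : ∀ {k : ℕ} (σ : Fin k → Fin m), Integrable (fun x : Fin m → Fin n → ℝ =>
      if Function.Injective σ then f (Set.range (x ∘ σ)) else 0)
      (volume.restrict (Set.univ.pi fun _ : Fin m => S)) := by
    intro k σ
    split_ifs
    · have hm : Measurable fun x : Fin m → Fin n → ℝ => x ∘ σ :=
        measurable_pi_lambda _ fun i => measurable_pi_apply (σ i)
      exact Measure.integrableOn_of_bounded hfinm.ne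
        ((hmeas k).comp hm).aestronglyMeasurable (ae_of_all _ fun x => hM _)
    · exact integrable_zero _ _ _
  rw [integral_congr_ae (ae_restrict_of_ae ((ae_injective hn m).mono fun x hx =>
      finsum_subset_range hsupp hx)),
    integral_finsetSum _ fun k _ => (integrable_finsetSum _ fun σ _ => h_int σ).const_mul _]
  refine Finset.sum_congr rfl fun k _ => ?_
  rw [integral_const_mul, integral_finsetSum _ fun σ _ => h_int σ, ← card_filter_injective,
    ← nsmul_eq_mul (Finset.card _), ← Finset.sum_const, Finset.sum_filter]
  congr 1
  refine Finset.sum_congr rfl fun σ _ => ?_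
  split_ifs with hσ
  · exact setIntegral_comp_injective hSfin hσ (hmeas k)
  · simp

theorem tsum_poisson_eq (hn : 1 ≤ n) (hS0 : 0 < volume S) (hSfin : volume S < ⊤)
    (hbdd : ∃ M : ℝ, ∀ X, |f X| ≤ M)
    (hmeas : ∀ m : ℕ, Measurable fun x : Fin m → (Fin n → ℝ) => f (Set.range x))
    (hsupp : ∀ X : Set (Fin n → ℝ), n ≤ X.ncard → f X = 0) :
    ∑' m : ℕ,
      (Real.exp (-(volume S).toReal) * (volume S).toReal ^ m / (Nat.factorial m) *
        ((volume S).toReal ^ m)⁻¹) *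
      ∫ x in Set.univ.pi (fun _ : Fin m => S),
        ∑ᶠ X ∈ {Y : Set (Fin n → ℝ) | Y ⊆ Set.range x}, f X =
    ∑ k ∈ Finset.range n, (k ! : ℝ)⁻¹ *
      ∫ x in Set.univ.pi (fun _ : Fin k => S), f (Set.range x) := by
  have ht : 0 < (volume S).toReal := ENNReal.toReal_pos hS0.ne' hSfin.ne
  set t := (volume S).toReal
  have h1 : HasSum (fun m : ℕ => ∑ k ∈ Finset.range n,
      (m.descFactorial k : ℝ) / m ! * t ^ (m - k) * (Real.exp (-t) * ((k ! : ℝ)⁻¹ *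
      ∫ x in Set.univ.pi (fun _ : Fin k => S), f (Set.range x))))
      (∑ k ∈ Finset.range n, Real.exp t * (Real.exp (-t) * ((k ! : ℝ)⁻¹ *
      ∫ x in Set.univ.pi (fun _ : Fin k => S), f (Set.range x)))) :=
    hasSum_sum fun k _ => (hasSum_descFactorial k t).mul_right _
  have h2 : ∀ y : ℝ, Real.exp t * (Real.exp (-t) * y) = y := fun y => by
    rw [← mul_assoc, ← Real.exp_add]; simp
  simp_rw [h2] at h1
  rw [← h1.tsum_eq]
  refine tsum_congr fun m => ?_
  rw [setIntegral_finsum_subset_range hn hSfin hbdd hmeas hsupp, Finset.mul_sum]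
  refine Finset.sum_congr rfl fun k _ => ?_
  change _ * (_ * (_ * (t ^ _ * _))) = _
  field_simp

end Poisson

section LatticeSide

open scoped Nat

variable {n : ℕ} {S : Set (Fin n → ℝ)} {f : Set (Fin n → ℝ) → ℝ}

/-- The linearly independent `k`-tuples of vectors of `S`. -/
def indepTuples (k : ℕ) (S : Set (Fin n → ℝ)) : Set (Fin k → Fin n → ℝ) :=
  (Set.univ.pi fun _ => S) ∩ {x | LinearIndependent ℝ x}

theorem measurableSet_indepTuples (k : ℕ) (hS : MeasurableSet S) :
    MeasurableSet (indepTuples k S) :=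
  (MeasurableSet.univ_pi fun _ => hS).inter isOpen_setOf_linearIndependent_tuple.measurableSet

theorem volume_indepTuples_lt_top (k : ℕ) (hS : volume S < ⊤) :
    volume (indepTuples k S) < ⊤ := by
  refine (measure_mono Set.inter_subset_left).trans_lt ?_
  rw [volume_pi_pi]
  exact ENNReal.prod_lt_top fun _ _ => hS

/-- The embedding of `ℤⁿ` onto the lattice `L`. -/
def latticeEmb (L : LatticeSpace n) (v : Fin n → ℤ) : Fin n → ℝ :=
  (Quotient.out (α := SLR n) L).1.mulVec fun i => (v i : ℝ)

theorem latticeEmb_injective (L : LatticeSpace n) : Function.Injective (latticeEmb L) := by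
  intro v w h
  have h1 := Matrix.mulVec_injective_of_isUnit (A := (Quotient.out (α := SLR n) L).1)
    ((Matrix.isUnit_iff_isUnit_det _).2 (by simp)) h
  funext i
  exact_mod_cast congrFun h1 i

theorem range_latticeEmb (L : LatticeSpace n) : Set.range (latticeEmb L) = latticeOf L := by
  ext y
  exact ⟨fun ⟨v, hv⟩ => ⟨v, hv.symm⟩, fun ⟨v, hv⟩ => ⟨v, hv.symm⟩⟩

open scoped Classical in
theorem indicator_indepTuples_comp (L : LatticeSpace n) {k : ℕ} (v : Fin k → Fin n → ℤ) :
    (if Function.Injective v then {Z | latticeEmb L '' Z ⊆ S}.indicator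
      (fun Z => f (latticeEmb L '' Z) * iota (latticeEmb L '' Z)) (Set.range v) else 0) =
    (indepTuples k S).indicator (fun x => f (Set.range x)) (latticeEmb L ∘ v) := by
  have hp := latticeEmb_injective L
  by_cases hv : Function.Injective v
  · have hi : indepSet (Set.range (latticeEmb L ∘ v)) ↔
        LinearIndependent ℝ (latticeEmb L ∘ v) := linearIndepOn_id_range_iff (hp.comp hv)
    have hS : latticeEmb L ∘ v ∈ (Set.univ.pi fun _ => S) ↔
        Set.range (latticeEmb L ∘ v) ⊆ S := by
      rw [Set.mem_univ_pi, Set.range_subset_iff]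
    simp only [if_pos hv, Set.indicator_apply, Set.mem_ofPred_eq, ← Set.range_comp, indepTuples,
      Set.mem_inter_iff, hS, iota, hi]
    split_ifs <;> simp_all
  · rw [if_neg hv, Set.indicator_of_notMem]
    exact fun h => hv (h.2.injective.of_comp)

theorem finsum_lattice_subsets
    (hsupp : ∀ X : Set (Fin n → ℝ), n ≤ X.ncard → f X = 0)
    (hfin : ∀ X : Set (Fin n → ℝ), X.Infinite → f X = 0) {L : LatticeSpace n}
    (hL : ∀ k < n, {v : Fin k → Fin n → ℤ | latticeEmb L ∘ v ∈ indepTuples k S}.Finite) :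
    ∑ᶠ X ∈ {Y : Set (Fin n → ℝ) | Y ⊆ latticeOf L ∩ S}, f X * iota X =
      ∑ k ∈ Finset.range n, (k ! : ℝ)⁻¹ * ∑ᶠ v : Fin k → Fin n → ℤ,
        (indepTuples k S).indicator (fun x => f (Set.range x)) (latticeEmb L ∘ v) := by
  classical
  have hp := latticeEmb_injective L
  have h1 : {Y : Set (Fin n → ℝ) | Y ⊆ latticeOf L ∩ S} =
      Set.image (latticeEmb L) '' {Z | latticeEmb L '' Z ⊆ S} := by
    ext Y
    simp only [Set.mem_ofPred_eq, Set.subset_inter_iff, ← range_latticeEmb,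
      Set.subset_range_iff_exists_image_eq, Set.mem_image]
    constructor
    · rintro ⟨⟨Z, rfl⟩, h⟩
      exact ⟨Z, h, rfl⟩
    · rintro ⟨Z, h, rfl⟩
      exact ⟨⟨Z, rfl⟩, h⟩
  rw [h1, finsum_mem_image hp.image_injective.injOn, finsum_mem_def,
    finsum_set_eq_sum_tuples (n := n) (fun Z hZ => ?_) fun k hk => (hL k hk).subset ?_]
  · refine Finset.sum_congr rfl fun k _ => congrArg _ (finsum_congr fun v => ?_)
    rw [← indicator_indepTuples_comp]
    congr!
  · have hfZ : f (latticeEmb L '' Z) ≠ 0 := fun h0 => hZ (by simp [Set.indicator_apply, h0])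
    refine ⟨?_, ?_⟩
    · by_contra hinf
      exact hfZ (hfin _ ((Set.infinite_image_iff hp.injOn).2 hinf))
    · by_contra! hle
      exact hfZ (hsupp _ (by rwa [Set.ncard_image_of_injective _ hp]))
  · rintro v ⟨hv, hne⟩
    have h2 := indicator_indepTuples_comp (f := f) (S := S) L v
    rw [if_pos hv] at h2
    rw [h2] at hne
    exact show latticeEmb L ∘ v ∈ indepTuples k S from Set.mem_of_indicator_ne_zero hne

theorem finsum_eq_toReal_tupleSum {k : ℕ} {h : (Fin k → Fin n → ℝ) → ℝ} {L : LatticeSpace n}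
    (hL : {v : Fin k → Fin n → ℤ | h (latticeEmb L ∘ v) ≠ 0}.Finite) :
    ∑ᶠ v : Fin k → Fin n → ℤ, h (latticeEmb L ∘ v) =
      (tupleSum (fun x => ENNReal.ofReal (h x)) L).toReal -
        (tupleSum (fun x => ENNReal.ofReal (-h x)) L).toReal := by
  have key : ∀ h' : (Fin k → Fin n → ℝ) → ℝ,
      (tupleSum (fun x => ENNReal.ofReal (h' x)) L).toReal =
        ∑' v : Fin k → Fin n → ℤ, max (h' (latticeEmb L ∘ v)) 0 := fun h' =>
    ENNReal.tsum_toReal_eq (fun v => ENNReal.ofReal_ne_top) |>.trans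
      (tsum_congr fun v => ENNReal.toReal_ofReal')
  have hs : ∀ h' : (Fin k → Fin n → ℝ) → ℝ, (∀ x, h x = 0 → h' x = 0) →
      Summable fun v : Fin k → Fin n → ℤ => max (h' (latticeEmb L ∘ v)) 0 := fun h' h0 =>
    summable_of_hasFiniteSupport (hL.subset fun v hv hz => hv (by simp [h0 _ hz]))
  rw [key, key fun x => -h x,
    ← (hs h fun _ => id).tsum_sub (hs (fun x => -h x) fun x hx => by simp [hx])]
  refine (tsum_eq_finsum (L := .unconditional _) hL).symm.trans ?_
  refine tsum_congr fun v => ?_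
  rcases le_total (h (latticeEmb L ∘ v)) 0 with h0 | h0
  · simp [h0]
  · simp [h0]

variable (μ : Measure (LatticeSpace n)) [IsProbabilityMeasure μ]

theorem ae_finite_indepTuples (hSmeas : MeasurableSet S) (hSfin : volume S < ⊤)
    (hinv : ∀ g : SLR n, Measure.map (fun x => g • x) μ = μ) {k : ℕ} (hk : k < n) :
    ∀ᵐ L ∂μ, {v : Fin k → Fin n → ℤ | latticeEmb L ∘ v ∈ indepTuples k S}.Finite := by
  have hm := measurableSet_indepTuples k hSmeas
  have h1 : Measurable ((indepTuples k S).indicator (1 : (Fin k → Fin n → ℝ) → ℝ≥0∞)) :=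
    measurable_one.indicator hm
  have h2 := lintegral_tupleSum_eq μ hinv hk h1 fun x hx =>
    Set.indicator_of_notMem (fun h => hx h.2) _
  rw [lintegral_indicator_one hm] at h2
  filter_upwards [ae_lt_top (measurable_tupleSum h1)
    (h2.trans_lt (volume_indepTuples_lt_top k hSfin)).ne] with L hL
  refine (ENNReal.finite_const_le_of_tsum_ne_top hL.ne one_ne_zero).subset fun v hv => ?_
  exact (Set.indicator_of_mem (show latticeEmb L ∘ v ∈ indepTuples k S from hv)
    (1 : (Fin k → Fin n → ℝ) → ℝ≥0∞)).ge

/-- The mean value theorem for real-valued functions on linearly independent tuples. -/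
theorem integral_toReal_tupleSum_sub
    (hinv : ∀ g : SLR n, Measure.map (fun x => g • x) μ = μ) {k : ℕ} (hk : k < n)
    {h : (Fin k → Fin n → ℝ) → ℝ} (hh : Measurable h) (hi : Integrable h)
    (h0 : ∀ x, ¬ LinearIndependent ℝ x → h x = 0) :
    Integrable (fun L => (tupleSum (fun x => ENNReal.ofReal (h x)) L).toReal -
      (tupleSum (fun x => ENNReal.ofReal (-h x)) L).toReal) μ ∧
    ∫ L, ((tupleSum (fun x => ENNReal.ofReal (h x)) L).toReal -
      (tupleSum (fun x => ENNReal.ofReal (-h x)) L).toReal) ∂μ = ∫ x, h x := by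
  have key : ∀ {h : (Fin k → Fin n → ℝ) → ℝ}, Measurable h → Integrable h →
      (∀ x, ¬ LinearIndependent ℝ x → h x = 0) →
      Integrable (fun L => (tupleSum (fun x => ENNReal.ofReal (h x)) L).toReal) μ ∧
      ∫ L, (tupleSum (fun x => ENNReal.ofReal (h x)) L).toReal ∂μ =
        (∫⁻ x, ENNReal.ofReal (h x)).toReal := by
    intro h hh hi h0
    have h1 := lintegral_tupleSum_eq μ hinv hk hh.ennreal_ofReal fun x hx => by simp [h0 x hx]
    have h2 : ∫⁻ L, tupleSum (fun x => ENNReal.ofReal (h x)) L ∂μ ≠ ⊤ := by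
      rw [h1]
      exact hi.lintegral_lt_top.ne
    have h3 := measurable_tupleSum hh.ennreal_ofReal
    exact ⟨integrable_toReal_of_lintegral_ne_top h3.aemeasurable h2, by
      rw [integral_toReal h3.aemeasurable (ae_lt_top h3 h2), h1]⟩
  obtain ⟨h1, h2⟩ := key hh hi h0
  obtain ⟨h3, h4⟩ := key hh.neg hi.neg fun x hx => by simp [h0 x hx]
  refine ⟨h1.sub h3, ?_⟩
  rw [integral_eq_lintegral_pos_part_sub_lintegral_neg_part hi, ← h2]
  exact (integral_sub h1 h3).trans (congrArg _ h4)

theorem integral_lattice_eq (hSmeas : MeasurableSet S) (hSfin : volume S < ⊤)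
    (hinv : ∀ g : SLR n, Measure.map (fun x => g • x) μ = μ)
    (hbdd : ∃ M : ℝ, ∀ X, |f X| ≤ M)
    (hmeas : ∀ m : ℕ, Measurable fun x : Fin m → (Fin n → ℝ) => f (Set.range x))
    (hsupp : ∀ X : Set (Fin n → ℝ), n ≤ X.ncard → f X = 0)
    (hfin : ∀ X : Set (Fin n → ℝ), X.Infinite → f X = 0) :
    ∫ L, (∑ᶠ X ∈ {Y : Set (Fin n → ℝ) | Y ⊆ latticeOf L ∩ S}, f X * iota X) ∂μ =
      ∑ k ∈ Finset.range n, (k ! : ℝ)⁻¹ *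
        ∫ x in Set.univ.pi (fun _ : Fin k => S), f (Set.range x) := by
  obtain ⟨M, hM⟩ := hbdd
  let h (k : ℕ) : (Fin k → Fin n → ℝ) → ℝ :=
    (indepTuples k S).indicator fun x => f (Set.range x)
  have hm : ∀ k, Measurable (h k) := fun k =>
    (hmeas k).indicator (measurableSet_indepTuples k hSmeas)
  have hi : ∀ k, Integrable (h k) := fun k =>
    (integrable_indicator_iff (measurableSet_indepTuples k hSmeas)).2
      (Measure.integrableOn_of_bounded (volume_indepTuples_lt_top k hSfin).ne
        (hmeas k).aestronglyMeasurable (ae_of_all _ fun x => hM _))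
  have h0 : ∀ k x, ¬ LinearIndependent ℝ x → h k x = 0 := fun k x hx =>
    Set.indicator_of_notMem (fun h => hx h.2) _
  have hae : ∀ᵐ L ∂μ, ∀ k < n,
      {v : Fin k → Fin n → ℤ | latticeEmb L ∘ v ∈ indepTuples k S}.Finite := by
    rw [ae_all_iff]
    intro k
    by_cases hk : k < n
    · filter_upwards [ae_finite_indepTuples μ hSmeas hSfin hinv hk] with L hL _ using hL
    · exact ae_of_all _ fun L hk' => absurd hk' hk
  rw [integral_congr_ae (g := fun L => ∑ k ∈ Finset.range n, (k ! : ℝ)⁻¹ *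
    ((tupleSum (fun x => ENNReal.ofReal (h k x)) L).toReal -
      (tupleSum (fun x => ENNReal.ofReal (-h k x)) L).toReal)),
    integral_finsetSum _ fun k hk => ?_]
  · refine Finset.sum_congr rfl fun k hk => ?_
    have hk' := Finset.mem_range.1 hk
    rw [integral_const_mul,
      (integral_toReal_tupleSum_sub μ hinv hk' (hm k) (hi k) (h0 k)).2,
      integral_indicator (measurableSet_indepTuples k hSmeas)]
    congr 1
    refine setIntegral_congr_set (inter_ae_eq_left_of_ae_eq_univ ?_)
    exact eventuallyEq_univ.2 (ae_linearIndependent hk'.le)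
  · exact (integral_toReal_tupleSum_sub μ hinv (Finset.mem_range.1 hk)
      (hm k) (hi k) (h0 k)).1.const_mul _
  · filter_upwards [hae] with L hL
    refine (finsum_lattice_subsets hsupp hfin hL).trans ?_
    refine Finset.sum_congr rfl fun k hk => congrArg _ ?_
    exact finsum_eq_toReal_tupleSum ((hL k (Finset.mem_range.1 hk)).subset fun v hv =>
      show latticeEmb L ∘ v ∈ indepTuples k S from Set.mem_of_indicator_ne_zero hv)

end LatticeSide

end

/-- **Proposition 1.1.** Let `S ⊆ ℝⁿ` be a Borel set with `S ∩ (-S) = ∅` and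
`0 < Vol(S) < ∞`, let `μ` be an `SL(n,ℝ)`-invariant Borel probability measure on the
space of covolume-one lattices, and let `f` be a bounded Borel function on the finite
subsets of `S` vanishing on sets of cardinality at least `n`. Then the `μ`-average of
`Σ_{X ⊆ L ∩ S} f(X)·ι(X)` equals the Poisson expectation `E_λ[A ↦ Σ_{X ⊆ A} f(X)]`. -/
theorem lattice_sum_eq_poisson_expectation
    (n : ℕ) (hn : 1 ≤ n)
    (S : Set (Fin n → ℝ)) (hSmeas : MeasurableSet S)
    (hSsym : S ∩ (-S) = ∅) (hS0 : 0 < volume S) (hSfin : volume S < ⊤)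
    (μ : Measure (LatticeSpace n)) (hprob : IsProbabilityMeasure μ)
    (hinv : ∀ g : SLR n, Measure.map (fun x => g • x) μ = μ)
    (f : Set (Fin n → ℝ) → ℝ)
    (hbdd : ∃ M : ℝ, ∀ X, |f X| ≤ M)
    (hmeas : ∀ m : ℕ, Measurable fun x : Fin m → (Fin n → ℝ) => f (Set.range x))
    (hsupp : ∀ X : Set (Fin n → ℝ), n ≤ X.ncard → f X = 0)
    (hfin : ∀ X : Set (Fin n → ℝ), X.Infinite → f X = 0) :
    ∫ L, (∑ᶠ X ∈ {Y : Set (Fin n → ℝ) | Y ⊆ latticeOf L ∩ S}, f X * iota X) ∂μ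
      = ∑' m : ℕ,
          (Real.exp (-(volume S).toReal) * (volume S).toReal ^ m / (Nat.factorial m) *
            ((volume S).toReal ^ m)⁻¹) *
          ∫ x in Set.univ.pi (fun _ : Fin m => S),
            ∑ᶠ X ∈ {Y : Set (Fin n → ℝ) | Y ⊆ Set.range x}, f X := by
  rw [integral_lattice_eq μ hSmeas hSfin hinv hbdd hmeas hsupp hfin,
    tsum_poisson_eq hn hS0 hSfin hbdd hmeas hsupp]
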